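/- arXiv:2411.18297 — 2 statements merged into one kernel-verified Lean document; each statement's English description precedes it below -/
import Mathlib

section
/- For the backward continued fraction: for every α ∈ [0,∞] (with the convention that the limit equals ∞ means the quantity tends to infinity), the set {x ∈ (0,1)∖ℚ : lim_{n→∞} max{a₁(x),…,a_n(x)}·(log log n)/n = α} has Hausdorff dimension 1, where a_n(x) are the backward continued fraction digits of x. -/
open Set MeasureTheory Filter Topology

open scoped ENNReal NNReal Classical

namespace ParabolicIFSPaper

noncomputable section

/-- Composition `φ_{ω₁} ∘ ⋯ ∘ φ_{ω_n}` for a (0-indexed) sequence of digits `ω`. -/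
def comp (φ : ℕ → ℝ → ℝ) (ω : ℕ → ℕ) : ℕ → ℝ → ℝ
  | 0 => id
  | n + 1 => comp φ ω n ∘ φ (ω n)

/-- Composition `φ_{a₁} ∘ ⋯ ∘ φ_{a_n}` along a finite word given as a list. -/
def wcomp (φ : ℕ → ℝ → ℝ) : List ℕ → ℝ → ℝ
  | [] => id
  | a :: l => φ a ∘ wcomp φ l

/-- A parabolic Iterated Function System on `[0,1]`:  an index set `I ⊆ ℕ` with at least two
elements, `C¹` maps `φ i : [0,1] → [0,1]`, the open set condition, the non-uniform contraction
condition (A1) with finitely many parabolic pairs, and the bounded distortion condition (A2). -/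
structure PIFS where
  I : Set ℕ
  I_nontrivial : I.Nontrivial
  φ : ℕ → ℝ → ℝ
  smooth : ∀ i ∈ I, ContDiff ℝ 1 (φ i)
  maps_to : ∀ i ∈ I, MapsTo (φ i) (Icc (0:ℝ) 1) (Icc (0:ℝ) 1)
  osc : ∀ i ∈ I, ∀ j ∈ I, i ≠ j → φ i '' Ioo (0:ℝ) 1 ∩ φ j '' Ioo (0:ℝ) 1 = ∅
  Par : Set ℕ
  Par_sub : Par ⊆ I
  Par_finite : Par.Finite
  fixpt : ℕ → ℝ
  fixpt_mem : ∀ i ∈ Par, fixpt i ∈ Icc (0:ℝ) 1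
  fixpt_fixed : ∀ i ∈ Par, φ i (fixpt i) = fixpt i
  fixpt_unique : ∀ i ∈ Par, ∀ x ∈ Icc (0:ℝ) 1, φ i x = x → x = fixpt i
  deriv_one : ∀ i ∈ Par, |deriv (φ i) (fixpt i)| = 1
  contracting : ∀ i ∈ I, ∀ x ∈ Icc (0:ℝ) 1, (i ∉ Par ∨ x ≠ fixpt i) → |deriv (φ i) x| < 1
  distC : ℝ
  distC_ge_one : 1 ≤ distC
  distortion : ∀ ω : ℕ → ℕ, (∀ k, ω k ∈ I) → ∀ n, 2 ≤ n →
    (ω (n - 1) ∉ Par ∨ ω (n - 2) ≠ ω (n - 1)) →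
    ∀ x ∈ Icc (0:ℝ) 1, ∀ y ∈ Icc (0:ℝ) 1,
      |deriv (comp φ ω n) x| ≤ distC * |deriv (comp φ ω n) y|

/-- The set of admissible digit sequences `I^ℕ`. -/
def PIFS.Seqs (Φ : PIFS) : Set (ℕ → ℕ) := {ω | ∀ k, ω k ∈ Φ.I}

/-- The set of admissible words of length `n`, i.e. `I^n`. -/
def Words (Φ : PIFS) (n : ℕ) : Set (List ℕ) := {l | l.length = n ∧ ∀ a ∈ l, a ∈ Φ.I}

/-- The fundamental interval `J(ω) = φ_ω([0,1])` of a finite word. -/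
def Jset (Φ : PIFS) (l : List ℕ) : Set ℝ := wcomp Φ.φ l '' Icc (0:ℝ) 1

/-- `Pi` is an address map for `Φ` if `Pi ω` lies in every fundamental interval
`φ_{ω₁⋯ω_n}([0,1])`; since these intersections are singletons for a parabolic IFS, this
characterizes the address map. -/
def IsAddressMap (Φ : PIFS) (Pi : (ℕ → ℕ) → ℝ) : Prop :=
  ∀ ω ∈ Φ.Seqs, ∀ n : ℕ, Pi ω ∈ comp Φ.φ ω n '' Icc (0:ℝ) 1

/-- The limit set `Λ(Φ) = Π(I^ℕ)`. -/
def limitSet (Φ : PIFS) (Pi : (ℕ → ℕ) → ℝ) : Set ℝ := Pi '' Φ.Seqs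

/-- The set `Λ_*(Φ)` of points having exactly one address. -/
def uniqueCoded (Φ : PIFS) (Pi : (ℕ → ℕ) → ℝ) : Set ℝ :=
  {x | ∃! ω : ℕ → ℕ, ω ∈ Φ.Seqs ∧ Pi ω = x}

/-- `max{a₁(x),…,a_n(x)} ⋅ (log log n) / n` for the digit sequence `ω`. -/
def ratio (ω : ℕ → ℕ) (n : ℕ) : ℝ :=
  ((((Finset.range n).sup ω : ℕ) : ℝ)) * Real.log (Real.log n) / n

/-- The level set `L(α)` of points whose largest-digit growth rate is `α ∈ [0,∞]`. -/
def levelSet (Φ : PIFS) (Pi : (ℕ → ℕ) → ℝ) (α : EReal) : Set ℝ :=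
  {x ∈ uniqueCoded Φ Pi |
    ∀ ω ∈ Φ.Seqs, Pi ω = x → Tendsto (fun n => (ratio ω n : EReal)) atTop (𝓝 α)}

/-- `Φ` is `d`-decaying: `min_x |φ_i'(x)| ≥ c / i^d`. -/
def Decaying (Φ : PIFS) (d : ℝ) : Prop :=
  ∃ c : ℝ, 0 < c ∧ ∀ i ∈ Φ.I, ∀ x ∈ Icc (0:ℝ) 1, c / (i : ℝ) ^ d ≤ |deriv (Φ.φ i) x|

/-- The shift map on sequence space. -/
def shift : (ℕ → ℕ) → (ℕ → ℕ) := fun ω n => ω (n + 1)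

/-- The Lyapunov exponent `χ(ν) = -∫ log |φ'_{ω₁}(Π ω)| dν(ω)` (in `[0,∞]`). -/
def lyap (Φ : PIFS) (Pi : (ℕ → ℕ) → ℝ) (ν : Measure (ℕ → ℕ)) : ℝ≥0∞ :=
  ∫⁻ ω, ENNReal.ofReal (- Real.log |deriv (Φ.φ (ω 0)) (Pi ω)|) ∂ν

/-- The class `𝓜(Φ)` of shift-invariant ergodic probability measures carried by `I^ℕ`
with finite Lyapunov exponent. -/
def MeasClass (Φ : PIFS) (Pi : (ℕ → ℕ) → ℝ) : Set (Measure (ℕ → ℕ)) :=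
  {ν | IsProbabilityMeasure ν ∧ ν Φ.Seqs = 1 ∧ Ergodic shift ν ∧ lyap Φ Pi ν < ⊤}

/-- `dim(μ) = inf {dim_H A : A ⊆ [0,1], μ(A) = 1}`. -/
def mdim (μ : Measure ℝ) : ℝ≥0∞ :=
  ⨅ (A : Set ℝ) (_ : A ⊆ Icc (0:ℝ) 1) (_ : μ A = 1), dimH A

/-- Condition (B1) (saturation). -/
def SatB1 (Φ : PIFS) (Pi : (ℕ → ℕ) → ℝ) : Prop :=
  dimH (limitSet Φ Pi) = ⨆ ν ∈ MeasClass Φ Pi, mdim (Measure.map Pi ν)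

/-- Condition (B2) (mild distortion): `D₁(Φ) < ∞` and `D_n(Φ) = o(n)`. -/
def MildB2 (Φ : PIFS) : Prop :=
  (∃ C : ℝ, ∀ i ∈ Φ.I, ∀ x ∈ Icc (0:ℝ) 1, ∀ y ∈ Icc (0:ℝ) 1,
    |deriv (Φ.φ i) x| ≤ C * |deriv (Φ.φ i) y|) ∧
  ∀ ε : ℝ, 0 < ε → ∃ N : ℕ, ∀ n, N ≤ n → ∀ l ∈ Words Φ n,
    ∀ x ∈ Icc (0:ℝ) 1, ∀ y ∈ Icc (0:ℝ) 1,
      |deriv (wcomp Φ.φ l) x| ≤ Real.exp (ε * n) * |deriv (wcomp Φ.φ l) y|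

/-- Composition along a sequence of finite words:
`φ_{σ₀} ∘ φ_{σ₁} ∘ ⋯ ∘ φ_{σ_{n-1}}`. -/
def seqComp (φ : ℕ → ℝ → ℝ) (σ : ℕ → List ℕ) : ℕ → ℝ → ℝ
  | 0 => id
  | n + 1 => seqComp φ σ n ∘ wcomp φ (σ n)

/-- The limit set of the finite IFS `{φ_w}_{w ∈ W}` indexed by words. -/
def finLimitSet (φ : ℕ → ℝ → ℝ) (W : Set (List ℕ)) : Set ℝ :=
  {x | ∃ σ : ℕ → List ℕ, (∀ k, σ k ∈ W) ∧ ∀ n, x ∈ seqComp φ σ n '' Icc (0:ℝ) 1}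

/-- `τ(x) = x / log log x`. -/
def tau (x : ℝ) : ℝ := x / Real.log (Real.log x)

/-- Number of insertion positions among `1,…,j`. -/
def cnt (nseq : ℕ → ℕ) (j : ℕ) : ℕ :=
  ((Finset.range (j + 1)).filter fun k => 1 ≤ k ∧ nseq k ≤ j).card

/-- Insertion of the digits `⌊α τ(n(k))⌋` at the positions `n(k)`, `k ≥ 1`, into the
(0-indexed) digit sequence `b`; index `m` corresponds to the (1-indexed) position `m + 1`. -/
def insertSeq (nseq : ℕ → ℕ) (α : ℝ) (b : ℕ → ℕ) : ℕ → ℕ := fun m =>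
  if ∃ k, 1 ≤ k ∧ nseq k = m + 1 then ⌊α * tau (m + 1)⌋₊
  else b (m - cnt nseq (m + 1))

/-- The digit sequence obtained by concatenating the words `σ 0, σ 1, …`, each of length `p`. -/
def flattenSeq (p : ℕ) (σ : ℕ → List ℕ) : ℕ → ℕ := fun m => (σ (m / p)).getD (m % p) 0

/-- The set `L_p(α)` of points obtained from points of `Λ(Φ_p)` by inserting the digits
`⌊α τ(n(k))⌋` at the positions `n(k)`. -/
def LpSet (Φ : PIFS) (Pi : (ℕ → ℕ) → ℝ) (W : Set (List ℕ)) (p : ℕ)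
    (nseq : ℕ → ℕ) (α : ℝ) : Set ℝ :=
  {x | ∃ σ : ℕ → List ℕ, (∀ k, σ k ∈ W) ∧ x = Pi (insertSeq nseq α (flattenSeq p σ))}

/-- The set `A_k` of admissible words `a₁ ⋯ a_{n(k+1)}` (0-indexed: `a 0 = a₁`):
each block between consecutive insertion positions is a concatenation of words of `W`,
and the digit at each insertion position `n(j+1)` is `⌊α τ(n(j+1))⌋`. -/
def Aset (Φ : PIFS) (W : Set (List ℕ)) (p : ℕ) (nseq mseq : ℕ → ℕ) (α : ℝ) (k : ℕ) :
    Set (ℕ → ℕ) :=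
  {a | (∀ i < nseq (k + 1), a i ∈ Φ.I) ∧
    ∀ j ≤ k,
      (∀ i < mseq j, ∃ w ∈ W, ∀ r < p, a (nseq j + i * p + r) = w.getD r 0) ∧
      a (nseq (j + 1) - 1) = ⌊α * tau (nseq (j + 1))⌋₊}

/-- `B_k = {n(k) + m p : m = 0,…,m(k)}`. -/
def Bset (nseq mseq : ℕ → ℕ) (p k : ℕ) : Set ℕ :=
  {n | ∃ m ≤ mseq k, n = nseq k + m * p}

/-- The composition `φ_{ā₁⋯ā_n}` along the word obtained from `a₁ ⋯ a_n` by eliminating the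
digits at the insertion positions `n(1), n(2), …` (0-indexed: index `n` ↔ position `n + 1`). -/
def elimComp (φ : ℕ → ℝ → ℝ) (nseq : ℕ → ℕ) (a : ℕ → ℕ) : ℕ → ℝ → ℝ
  | 0 => id
  | n + 1 =>
    if ∃ k, 1 ≤ k ∧ nseq k = n + 1 then elimComp φ nseq a n
    else elimComp φ nseq a n ∘ φ (a n)

/-- The minimal distance `K` between distinct fundamental intervals `J(w)`, `w ∈ W`. -/
def Kdist (Φ : PIFS) (W : Set (List ℕ)) : ℝ :=
  sInf {r | ∃ w ∈ W, ∃ w' ∈ W, w ≠ w' ∧ ∃ u ∈ Jset Φ w, ∃ v ∈ Jset Φ w', r = |u - v|}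

/-- The data of the insertion construction of Section 3 of the paper: a `d`-decaying
parabolic IFS `Φ` with address map `Pi` satisfying (B1) and (B2), `ε > 0`, an integer `p ≥ 2`
with `(k+p+1)^d + 2p + 1 < (k+p+2)^d`, a finite set `W ⊆ I^p` of words with pairwise disjoint
fundamental intervals, non-parabolic last letters, uniform contraction rate `e^{-γp}` and
limit set of dimension `> dim_H Λ(Φ) - ε`, the insertion positions `n(k)` (with the block
lengths `m(k)`), and `α ∈ (0,∞)`, the inserted digits `⌊α τ(n(k))⌋` belonging to `I`. -/
structure InsSetup (Φ : PIFS) (Pi : (ℕ → ℕ) → ℝ) where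
  d : ℝ
  hd : 1 < d
  hdec : Decaying Φ d
  hPi : IsAddressMap Φ Pi
  hPiMeas : Measurable Pi
  hB1 : SatB1 Φ Pi
  hB2 : MildB2 Φ
  ε : ℝ
  hε : 0 < ε
  p : ℕ
  hp2 : 2 ≤ p
  hpd : ∀ k : ℕ, ((k : ℝ) + p + 1) ^ d + 2 * p + 1 < ((k : ℝ) + p + 2) ^ d
  W : Finset (List ℕ)
  hWne : W.Nonempty
  hWsub : (↑W : Set (List ℕ)) ⊆ Words Φ p
  hWdisj : ∀ w ∈ W, ∀ w' ∈ W, w ≠ w' → Jset Φ w ∩ Jset Φ w' = ∅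
  hWlast : ∀ w ∈ W, ∀ h : w ≠ [], w.getLast h ∉ Φ.Par
  γ : ℝ
  hγ : 0 < γ
  hWcontr : ∀ w ∈ W, ∀ x ∈ Icc (0:ℝ) 1, |deriv (wcomp Φ.φ w) x| < Real.exp (-(γ * p))
  hWdim : dimH (limitSet Φ Pi) - ENNReal.ofReal ε < dimH (finLimitSet Φ.φ (↑W : Set (List ℕ)))
  α : ℝ
  hα : 0 < α
  nseq : ℕ → ℕ
  mseq : ℕ → ℕ
  hn0 : nseq 0 = 0
  hm2 : ∀ k, 2 ≤ mseq k
  hmlow : ∀ k : ℕ, (nseq k : ℝ) + ((mseq k : ℝ) - 1) * p ≤ ((k : ℝ) + p + 1) ^ d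
  hmhigh : ∀ k : ℕ, ((k : ℝ) + p + 1) ^ d < (nseq k : ℝ) + (mseq k : ℝ) * p
  hnrec : ∀ k, nseq (k + 1) = nseq k + mseq k * p + 1
  hins : ∀ k, 1 ≤ k → ⌊α * tau (nseq k)⌋₊ ∈ Φ.I

/-- The maps `φ_i(x) = 1 - 1/(x+i-1)` generating the backward continued fraction. -/
def bcf : ℕ → ℝ → ℝ := fun i x => 1 - 1 / (x + i - 1)

/-- The effect of appending the digit `i` on the bottom row of the matrix of a composition of
the maps `bcf`. -/
def digitRow (v : ℕ × ℕ) (i : ℕ) : ℕ × ℕ := (v.1 + v.2, v.1 * (i - 2) + v.2 * (i - 1))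

/-- The effect of appending a word on the bottom row. -/
def wordRow (l : List ℕ) (v : ℕ × ℕ) : ℕ × ℕ := l.foldl digitRow v

@[simp] lemma wordRow_nil (v : ℕ × ℕ) : wordRow [] v = v := rfl

@[simp] lemma wordRow_cons (i : ℕ) (l : List ℕ) (v : ℕ × ℕ) :
    wordRow (i :: l) v = wordRow l (digitRow v i) := rfl

@[simp] lemma wordRow_append (l l' : List ℕ) (v : ℕ × ℕ) :
    wordRow (l ++ l') v = wordRow l' (wordRow l v) := by
  simp [wordRow, List.foldl_append]

lemma digitRow_mono (i : ℕ) : Monotone fun v => digitRow v i := by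
  intro u v h
  obtain ⟨h1, h2⟩ := h
  refine ⟨?_, ?_⟩ <;> simp only [digitRow] <;> gcongr

lemma wordRow_mono (l : List ℕ) : Monotone (wordRow l) := by
  induction l with
  | nil => exact fun _ _ h => h
  | cons i l ih => exact fun u v h => ih (digitRow_mono i h)

lemma wordRow_linear (l : List ℕ) (m n : ℕ) (u v : ℕ × ℕ) :
    wordRow l (m • u + n • v) = m • wordRow l u + n • wordRow l v := by
  induction l generalizing u v with
  | nil => rfl
  | cons i l ih =>
    rw [wordRow_cons, wordRow_cons, wordRow_cons, ← ih]
    congr 1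
    ext <;> simp [digitRow] <;> ring

lemma wordRow_one_zero_snd_le (l : List ℕ) : (wordRow l (1, 0)).2 ≤ (wordRow l (0, 1)).2 := by
  cases l with
  | nil => simp
  | cons i l =>
    refine (wordRow_mono l (a := digitRow (1, 0) i) (b := digitRow (0, 1) i) ?_).2
    refine ⟨by simp [digitRow], ?_⟩
    simp only [digitRow]
    omega

lemma wordRow_snd_le (l : List ℕ) (v : ℕ × ℕ) (hv : v.1 ≤ v.2) :
    (wordRow l v).2 ≤ 2 * v.2 * (wordRow l (0, 1)).2 := by
  have h := wordRow_linear l v.1 v.2 (1, 0) (0, 1)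
  have hv' : v.1 • ((1, 0) : ℕ × ℕ) + v.2 • ((0, 1) : ℕ × ℕ) = v := by ext <;> simp
  rw [hv'] at h
  have h1 := wordRow_one_zero_snd_le l
  rw [h]
  simp only [Prod.snd_add, Prod.smul_snd, smul_eq_mul]
  nlinarith [Nat.mul_le_mul hv h1]

lemma le_digitRow_snd (v : ℕ × ℕ) {i : ℕ} (hi : 2 ≤ i) : v.2 ≤ (digitRow v i).2 := by
  simp only [digitRow]
  have : v.2 * 1 ≤ v.2 * (i - 1) := Nat.mul_le_mul_left _ (by omega)
  omega

lemma le_wordRow_snd (l : List ℕ) (v : ℕ × ℕ) (hl : ∀ i ∈ l, 2 ≤ i) : v.2 ≤ (wordRow l v).2 := by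
  induction l generalizing v with
  | nil => exact le_rfl
  | cons i l ih =>
    exact (le_digitRow_snd v (hl i (by simp))).trans (ih _ fun j hj => hl j (by simp [hj]))

/-- Every coprime pair of positive integers is the bottom row of a word. -/
lemma exists_wordRow_eq (r s : ℕ) (hr : 1 ≤ r) (hs : 1 ≤ s) (hc : Nat.Coprime r s) :
    ∃ l : List ℕ, (∀ i ∈ l, 2 ≤ i) ∧ wordRow l (0, 1) = (r, s) := by
  induction r using Nat.strong_induction_on generalizing s with
  | _ r ih =>
    obtain ⟨k, r₀, hk, hr₀⟩ : ∃ k r₀, r * k = s + r₀ ∧ r₀ < r := by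
      refine ⟨(s + r - 1) / r, r * ((s + r - 1) / r) - s, ?_, ?_⟩ <;>
      · have h1 := Nat.div_add_mod (s + r - 1) r
        have h2 := Nat.mod_lt (s + r - 1) (show 0 < r by omega)
        omega
    have hk1 : 1 ≤ k := by
      rcases Nat.eq_zero_or_pos k with rfl | h
      · omega
      · exact h
    rcases Nat.eq_zero_or_pos r₀ with rfl | hpos
    · have hr1 : r = 1 := by
        have : r ∣ s := ⟨k, by omega⟩
        exact Nat.Coprime.eq_one_of_dvd hc this
      subst hr1
      exact ⟨[s + 1], by simp; omega, by simp [digitRow]⟩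
    · have hc' : Nat.Coprime r₀ (r - r₀) := by
        rw [Nat.coprime_sub_self_right hr₀.le]
        have h1 : Nat.Coprime r (s + r₀ - s) := by
          rw [← hk]
          have : Nat.gcd r (r * k - s) ∣ 1 := by
            have hd := Nat.gcd_dvd_left r (r * k - s)
            have hd2 := Nat.gcd_dvd_right r (r * k - s)
            have hd3 : Nat.gcd r (r * k - s) ∣ r * k - (r * k - s) :=
              Nat.dvd_sub (hd.mul_right k) hd2
            rw [Nat.sub_sub_self (by omega)] at hd3
            rw [← hc]
            exact Nat.dvd_gcd hd hd3
          exact Nat.dvd_one.mp this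
        rw [Nat.add_sub_cancel_left] at h1
        exact h1.symm
      obtain ⟨l, hl, hrow⟩ := ih r₀ hr₀ (r - r₀) hpos (by omega) hc'
      refine ⟨l ++ [k + 1], ?_, ?_⟩
      · intro i hi
        rcases List.mem_append.mp hi with h | h
        · exact hl i h
        · simp at h; omega
      · rw [wordRow_append, hrow]
        obtain ⟨j, rfl⟩ : ∃ j, k = j + 1 := ⟨k - 1, by omega⟩
        obtain ⟨d, rfl⟩ : ∃ d, r = r₀ + d := ⟨r - r₀, by omega⟩
        simp only [wordRow_cons, wordRow_nil, digitRow, Nat.add_sub_cancel_left]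
        ext
        · rfl
        · simp
          nlinarith

lemma sq_le_sum_totient (Q : ℕ) :
    Q ^ 2 ≤ 16 * ∑ s ∈ Finset.Ioc (Q / 4) Q, Nat.totient s := by
  have h1 : ∑ n ∈ Finset.Ioc 0 Q, n = ∑ n ∈ Finset.Ioc 0 Q, n.totient * (Q / n) := by
    let f : ArithmeticFunction ℕ := ⟨Nat.totient, Nat.totient_zero⟩
    have h := ArithmeticFunction.sum_Ioc_mul_zeta_eq_sum f Q
    simp only [ArithmeticFunction.coe_mul_zeta_apply] at h
    calc ∑ n ∈ Finset.Ioc 0 Q, n = ∑ n ∈ Finset.Ioc 0 Q, ∑ i ∈ n.divisors, f i :=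
          Finset.sum_congr rfl fun n _ => (Nat.sum_totient n).symm
      _ = _ := by simp only [Nat.cast_id] at h; exact h
  have h2 : Q * Q ≤ 2 * ∑ n ∈ Finset.Ioc 0 Q, n := by
    have : ∑ n ∈ Finset.Ioc 0 Q, n = ∑ n ∈ Finset.range (Q + 1), n := by
      rw [Finset.range_eq_Ico, Finset.sum_eq_sum_Ico_succ_bot (by omega), zero_add]
      rfl
    rw [this, mul_comm 2, Finset.sum_range_id_mul_two]
    simp only [Nat.add_sub_cancel]
    nlinarith
  have h3 : Finset.Ioc 0 Q = Finset.Ioc 0 (Q / 4) ∪ Finset.Ioc (Q / 4) Q :=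
    (Finset.Ioc_union_Ioc_eq_Ioc (zero_le) (Nat.div_le_self _ _)).symm
  have h4 : ∑ n ∈ Finset.Ioc 0 Q, n.totient * (Q / n) =
      ∑ n ∈ Finset.Ioc 0 (Q / 4), n.totient * (Q / n) +
        ∑ n ∈ Finset.Ioc (Q / 4) Q, n.totient * (Q / n) := by
    rw [h3, Finset.sum_union]
    rw [Finset.disjoint_left]
    intro a ha hb
    simp only [Finset.mem_Ioc] at ha hb
    omega
  have h5 : ∑ n ∈ Finset.Ioc 0 (Q / 4), n.totient * (Q / n) ≤ (Q / 4) * Q := by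
    calc ∑ n ∈ Finset.Ioc 0 (Q / 4), n.totient * (Q / n)
        ≤ ∑ n ∈ Finset.Ioc 0 (Q / 4), Q := by
          refine Finset.sum_le_sum fun n _ => ?_
          exact (Nat.mul_le_mul_right _ (Nat.totient_le n)).trans (Nat.mul_div_le Q n)
      _ = (Q / 4) * Q := by simp
  have h6 : ∑ n ∈ Finset.Ioc (Q / 4) Q, n.totient * (Q / n) ≤
      ∑ n ∈ Finset.Ioc (Q / 4) Q, n.totient * 4 := by
    refine Finset.sum_le_sum fun n hn => ?_
    simp only [Finset.mem_Ioc] at hn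
    refine Nat.mul_le_mul_left _ ?_
    rw [Nat.div_le_iff_le_mul_add_pred (by omega)]
    omega
  rw [← Finset.sum_mul] at h6
  have h7 : 4 * (Q / 4 * Q) ≤ Q * Q := by
    have : 4 * (Q / 4) ≤ Q := Nat.mul_div_le Q 4
    nlinarith
  nlinarith

/-- A large finite family of words, none of which is a prefix of another one, whose fundamental
intervals have comparable lengths and nearly fill the unit interval. -/
lemma exists_blocks (Q : ℕ) : ∃ (b : ℕ) (W : Fin b → List ℕ), Q ^ 2 ≤ 16 * b ∧
    (∀ i, ∀ d ∈ W i, 2 ≤ d) ∧ (∀ i, (wordRow (W i) (0, 1)).2 ≤ 14 * Q) ∧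
    (∀ i v, (wordRow (W i) v).1 ≤ (wordRow (W i) v).2) ∧
    (∀ i j, W i <+: W j → i = j) ∧ ∀ i, ∃ l, W i = 2 :: l := by
  let A : Finset (Σ _ : ℕ, ℕ) := (Finset.Ioc (Q / 4) Q).sigma
    fun s => (Finset.range s).filter fun r => Nat.Coprime s r
  have hcard : A.card = ∑ s ∈ Finset.Ioc (Q / 4) Q, Nat.totient s := by
    simp [A, Finset.card_sigma, Nat.totient]
  have hA : ∀ x ∈ A, Q / 4 < x.1 ∧ x.1 ≤ Q ∧ x.2 < x.1 ∧ Nat.Coprime x.1 x.2 := by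
    intro x hx
    simp only [A, Finset.mem_sigma, Finset.mem_Ioc, Finset.mem_filter, Finset.mem_range] at hx
    tauto
  have hword : ∀ x : A, ∃ l : List ℕ, (∀ i ∈ l, 2 ≤ i) ∧
      wordRow l (0, 1) = (x.1.1 - x.1.2, x.1.1) := by
    intro x
    obtain ⟨h1, h2, h3, h4⟩ := hA x.1 x.2
    refine exists_wordRow_eq _ _ (by omega) (by omega) ?_
    rw [Nat.coprime_comm, Nat.coprime_self_sub_right h3.le]
    exact h4
  choose w hw2 hwrow using hword
  let e : Fin A.card ≃ A := A.equivFin.symm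
  refine ⟨A.card, fun i => 2 :: (w (e i) ++ [5]), ?_, ?_, ?_, ?_, ?_, ?_⟩
  · rw [hcard]; exact sq_le_sum_totient Q
  · intro i d hd
    simp only [List.mem_cons, List.mem_append, List.not_mem_nil, or_false] at hd
    rcases hd with h | h | h
    · omega
    · exact hw2 _ d h
    · omega
  · intro i
    obtain ⟨h1, h2, h3, h4⟩ := hA (e i).1 (e i).2
    have h := wordRow_snd_le (w (e i) ++ [5]) (digitRow (0, 1) 2) (by simp [digitRow])
    rw [wordRow_append, wordRow_append, hwrow] at h
    rw [wordRow_cons, wordRow_append]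
    refine h.trans ?_
    simp [digitRow]
    omega
  · intro i v
    rw [wordRow_cons, wordRow_append]
    simp [digitRow]
    omega
  · intro i j hij
    rw [List.prefix_cons_inj] at hij
    apply e.injective
    apply Subtype.ext
    obtain ⟨h1, h2, h3, h4⟩ := hA (e i).1 (e i).2
    obtain ⟨h1', h2', h3', h4'⟩ := hA (e j).1 (e j).2
    rcases List.prefix_concat_iff.mp hij with h | h
    · have h5 : w (e i) = w (e j) := List.append_cancel_right h
      have h6 := hwrow (e i)
      rw [h5, hwrow (e j), Prod.mk.injEq] at h6
      refine Sigma.ext h6.2.symm (heq_of_eq ?_)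
      omega
    · exfalso
      obtain ⟨t, ht⟩ := h
      have h5 := le_wordRow_snd t (wordRow (w (e i) ++ [5]) (0, 1)) (fun d hd => by
        refine hw2 (e j) d ?_
        rw [← ht]; simp [hd])
      rw [← wordRow_append, ht, hwrow, wordRow_append, hwrow] at h5
      simp [digitRow] at h5
      omega
  · exact fun i => ⟨_, rfl⟩

/-- The bottom row of the matrix of `comp bcf a n`. -/
def seqRow (a : ℕ → ℕ) (n : ℕ) : ℕ × ℕ := wordRow ((List.range n).map a) (0, 1)

lemma seqRow_zero (a : ℕ → ℕ) : seqRow a 0 = (0, 1) := rfl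

lemma seqRow_succ (a : ℕ → ℕ) (n : ℕ) : seqRow a (n + 1) = digitRow (seqRow a n) (a n) := by
  simp [seqRow, List.range_succ]

section Comp

variable {a : ℕ → ℕ}

lemma bcf_mem {i : ℕ} (hi : 2 ≤ i) {x : ℝ} (hx : x ∈ Icc (0 : ℝ) 1) :
    bcf i x ∈ Icc (0 : ℝ) 1 := by
  have hi' : (2 : ℝ) ≤ i := by exact_mod_cast hi
  have hpos : (1 : ℝ) ≤ x + i - 1 := by linarith [hx.1]
  have h1 : 1 / (x + i - 1) ≤ 1 := by rw [div_le_one (by linarith)]; exact hpos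
  have h2 : 0 ≤ 1 / (x + i - 1) := by positivity
  exact ⟨by simp only [bcf]; linarith, by simp only [bcf]; linarith⟩

lemma one_le_seqRow_snd (ha : ∀ k, 2 ≤ a k) (n : ℕ) : 1 ≤ (seqRow a n).2 := by
  induction n with
  | zero => exact le_rfl
  | succ n ih => rw [seqRow_succ]; exact ih.trans (le_digitRow_snd _ (ha n))

lemma comp_sub_comp (ha : ∀ k, 2 ≤ a k) (n : ℕ) {x y : ℝ} (hx : x ∈ Icc (0 : ℝ) 1)
    (hy : y ∈ Icc (0 : ℝ) 1) :
    comp bcf a n y - comp bcf a n x = (y - x) /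
      (((seqRow a n).1 * y + (seqRow a n).2) * ((seqRow a n).1 * x + (seqRow a n).2)) := by
  induction n generalizing x y with
  | zero => simp [comp, seqRow_zero]
  | succ n ih =>
    have h1 : (1 : ℝ) ≤ (seqRow a n).2 := by exact_mod_cast one_le_seqRow_snd ha n
    have hai : (2 : ℝ) ≤ a n := by exact_mod_cast ha n
    simp only [comp, Function.comp_apply]
    rw [ih (bcf_mem (ha n) hx) (bcf_mem (ha n) hy), seqRow_succ]
    obtain ⟨i, hi⟩ : ∃ i, a n = i + 2 := ⟨a n - 2, by have := ha n; omega⟩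
    have hfx := bcf_mem (ha n) hx
    have hfy := bcf_mem (ha n) hy
    set r : ℝ := ((seqRow a n).1 : ℝ) with hr
    set s : ℝ := ((seqRow a n).2 : ℝ) with hs
    have hr0 : 0 ≤ r := by positivity
    have key : ∀ z ∈ Icc (0 : ℝ) 1, (z + i + 1) * (r * bcf (a n) z + s) =
        ((digitRow (seqRow a n) (a n)).1 : ℝ) * z + ((digitRow (seqRow a n) (a n)).2 : ℝ) := by
      intro z hz
      have : z + i + 1 ≠ 0 := by have := hz.1; positivity
      have h2 : z + (i + 2) - 1 = z + i + 1 := by ring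
      simp only [digitRow, bcf, hi]
      push_cast
      rw [h2]
      simp only [← hr, ← hs]
      field_simp
      ring
    rw [← key x hx, ← key y hy]
    have hxp : 0 < x + i + 1 := by have := hx.1; positivity
    have hyp : 0 < y + i + 1 := by have := hy.1; positivity
    have hxp' : 0 < r * bcf (a n) x + s := by have := hfx.1; positivity
    have hyp' : 0 < r * bcf (a n) y + s := by have := hfy.1; positivity
    have hd : bcf (a n) y - bcf (a n) x = (y - x) / ((y + i + 1) * (x + i + 1)) := by
      simp only [bcf, hi]
      push_cast
      rw [show x + ((i : ℝ) + 2) - 1 = x + i + 1 by ring,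
        show y + ((i : ℝ) + 2) - 1 = y + i + 1 by ring]
      field_simp
      ring
    rw [hd, div_div]
    congr 1
    ring

lemma comp_mono (ha : ∀ k, 2 ≤ a k) (n : ℕ) {x y : ℝ} (hx : x ∈ Icc (0 : ℝ) 1)
    (hy : y ∈ Icc (0 : ℝ) 1) (hxy : x ≤ y) : comp bcf a n x ≤ comp bcf a n y := by
  have h := comp_sub_comp ha n hx hy
  have h0 := hx.1
  have h0' := hy.1
  have : 0 ≤ comp bcf a n y - comp bcf a n x := by
    rw [h]; exact div_nonneg (by linarith) (by positivity)
  linarith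

lemma comp_mem (ha : ∀ k, 2 ≤ a k) (n : ℕ) {x : ℝ} (hx : x ∈ Icc (0 : ℝ) 1) :
    comp bcf a n x ∈ Icc (0 : ℝ) 1 := by
  induction n generalizing x with
  | zero => exact hx
  | succ n ih => exact ih (bcf_mem (ha n) hx)

lemma zero_mem_unit : (0 : ℝ) ∈ Icc (0 : ℝ) 1 := ⟨le_rfl, zero_le_one⟩

lemma one_mem_unit : (1 : ℝ) ∈ Icc (0 : ℝ) 1 := ⟨zero_le_one, le_rfl⟩

lemma comp_zero_monotone (ha : ∀ k, 2 ≤ a k) : Monotone fun n => comp bcf a n 0 :=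
  monotone_nat_of_le_succ fun n =>
    comp_mono ha n zero_mem_unit (bcf_mem (ha n) zero_mem_unit) (bcf_mem (ha n) zero_mem_unit).1

lemma comp_one_antitone (ha : ∀ k, 2 ≤ a k) : Antitone fun n => comp bcf a n 1 :=
  antitone_nat_of_succ_le fun n =>
    comp_mono ha n (bcf_mem (ha n) one_mem_unit) one_mem_unit (bcf_mem (ha n) one_mem_unit).2

/-- The point of the unit interval with a given digit sequence. -/
def value (a : ℕ → ℕ) : ℝ := ⨆ n, comp bcf a n 0

lemma tendsto_value (ha : ∀ k, 2 ≤ a k) :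
    Tendsto (fun n => comp bcf a n 0) atTop (𝓝 (value a)) :=
  tendsto_atTop_ciSup (comp_zero_monotone ha)
    ⟨1, by rintro _ ⟨n, rfl⟩; exact (comp_mem ha n zero_mem_unit).2⟩

lemma comp_zero_le_value (ha : ∀ k, 2 ≤ a k) (n : ℕ) : comp bcf a n 0 ≤ value a :=
  (comp_zero_monotone ha).ge_of_tendsto (tendsto_value ha) n

lemma value_le_comp_one (ha : ∀ k, 2 ≤ a k) (n : ℕ) : value a ≤ comp bcf a n 1 := by
  refine le_of_tendsto (tendsto_value ha) ?_
  filter_upwards [eventually_ge_atTop n] with m hm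
  exact (comp_mono ha m zero_mem_unit one_mem_unit zero_le_one).trans (comp_one_antitone ha hm)

lemma value_mem (ha : ∀ k, 2 ≤ a k) : value a ∈ Icc (0 : ℝ) 1 :=
  ⟨comp_zero_le_value ha 0, value_le_comp_one ha 0⟩

end Comp

lemma comp_congr {φ : ℕ → ℝ → ℝ} {a a' : ℕ → ℕ} {n : ℕ} (h : ∀ i < n, a i = a' i) :
    comp φ a n = comp φ a' n := by
  induction n with
  | zero => rfl
  | succ n ih => simp only [comp, ih fun i hi => h i (by omega), h n (by omega)]

lemma value_add_le_of_lt {a a' : ℕ → ℕ} (ha : ∀ k, 2 ≤ a k) (ha' : ∀ k, 2 ≤ a' k) {m n T : ℕ}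
    (hagree : ∀ i < m, a i = a' i) (hlt : a m < a' m) (hmn : m < n)
    (hrow : (seqRow a n).1 ≤ (seqRow a n).2) (hT : (seqRow a n).2 ≤ T) (han : a n = 2) :
    value a + 1 / (8 * (T : ℝ) ^ 2) ≤ value a' := by
  have hhalf : bcf 2 1 = 1 / 2 := by norm_num [bcf]
  have hhm : (1 / 2 : ℝ) ∈ Icc (0 : ℝ) 1 := ⟨by norm_num, by norm_num⟩
  have h1 : value a ≤ comp bcf a n (1 / 2) := by
    have := value_le_comp_one ha (n + 1)
    simpa only [comp, Function.comp_apply, han, hhalf] using this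
  have h2 : comp bcf a n 1 ≤ comp bcf a (m + 1) 1 := comp_one_antitone ha hmn
  have h3 : comp bcf a (m + 1) 1 ≤ comp bcf a' (m + 1) 0 := by
    simp only [comp, Function.comp_apply]
    rw [comp_congr hagree]
    refine comp_mono ha' m (bcf_mem (ha m) one_mem_unit) (bcf_mem (ha' m) zero_mem_unit) ?_
    have h4 : (2 : ℝ) ≤ a m := by exact_mod_cast ha m
    have h5 : (a m : ℝ) + 1 ≤ a' m := by exact_mod_cast hlt
    simp only [bcf]
    have : 1 / (0 + (a' m : ℝ) - 1) ≤ 1 / (1 + (a m : ℝ) - 1) := by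
      apply one_div_le_one_div_of_le <;> linarith
    linarith
  have h6 := comp_zero_le_value ha' (m + 1)
  have h7 := comp_sub_comp ha n hhm one_mem_unit
  have h8 : (1 : ℝ) ≤ (seqRow a n).2 := by exact_mod_cast one_le_seqRow_snd ha n
  have h9 : ((seqRow a n).1 : ℝ) ≤ (seqRow a n).2 := by exact_mod_cast hrow
  have h10 : ((seqRow a n).2 : ℝ) ≤ T := by exact_mod_cast hT
  have h11 : 1 / (8 * (T : ℝ) ^ 2) ≤ comp bcf a n 1 - comp bcf a n (1 / 2) := by
    rw [h7, show (1 : ℝ) - 1 / 2 = 1 / 2 by norm_num, div_div]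
    have hr0 : (0 : ℝ) ≤ (seqRow a n).1 := by positivity
    apply one_div_le_one_div_of_le
    · positivity
    · have : ((seqRow a n).1 * 1 + (seqRow a n).2 : ℝ) * ((seqRow a n).1 * (1 / 2) + (seqRow a n).2)
          ≤ (2 * T) * (2 * T) := by
        gcongr <;> linarith
      nlinarith
  linarith

lemma one_div_le_abs_value_sub {a a' : ℕ → ℕ} (ha : ∀ k, 2 ≤ a k) (ha' : ∀ k, 2 ≤ a' k)
    {n n' T : ℕ} (hne : ∃ i, i < n ∧ i < n' ∧ a i ≠ a' i)
    (hrow : (seqRow a n).1 ≤ (seqRow a n).2) (hT : (seqRow a n).2 ≤ T) (han : a n = 2)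
    (hrow' : (seqRow a' n').1 ≤ (seqRow a' n').2) (hT' : (seqRow a' n').2 ≤ T)
    (han' : a' n' = 2) :
    1 / (8 * (T : ℝ) ^ 2) ≤ |value a - value a'| := by
  obtain ⟨i, hin, hin', hi⟩ := hne
  have hex : ∃ i, a i ≠ a' i := ⟨i, hi⟩
  have hm := Nat.find_spec hex
  have hmin : ∀ j < Nat.find hex, a j = a' j := fun j hj => not_not.mp (Nat.find_min hex hj)
  have hle : Nat.find hex ≤ i := Nat.find_min' hex hi
  rcases lt_or_gt_of_ne hm with h | h
  · have := value_add_le_of_lt ha ha' hmin h (by omega) hrow hT han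
    rw [abs_sub_comm]
    exact (by linarith : _ ≤ value a' - value a).trans (le_abs_self _)
  · have := value_add_le_of_lt ha' ha (fun j hj => (hmin j hj).symm) h (by omega) hrow' hT' han'
    exact (by linarith : _ ≤ value a - value a').trans (le_abs_self _)

/-- The word inserted in front of the `k`-th block, if `n` digits precede that block. Digits are
only inserted at sparse times, and only if they are not too large. -/
def insertion (H : ℕ → ℕ) (k n : ℕ) : List ℕ :=
  if Nat.sqrt (k + 1) ≠ Nat.sqrt k ∧ 3 * max 3 (H n) ≤ 2 ^ (2 * Nat.sqrt k + 1)
  then [2, max 3 (H n)] else []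

/-- The concatenation of the first `k` blocks of `w`, including the inserted words. -/
def stage (H : ℕ → ℕ) (w : ℕ → List ℕ) : ℕ → List ℕ
  | 0 => []
  | k + 1 => stage H w k ++ (insertion H k (stage H w k).length ++ w k)

/-- The infinite concatenation of the blocks of `w`, including the inserted words. -/
def digitSeq (H : ℕ → ℕ) (w : ℕ → List ℕ) (i : ℕ) : ℕ := (stage H w (i + 1)).getD i 0

section Stage

variable {H : ℕ → ℕ} {w : ℕ → List ℕ}

lemma stage_prefix {j k : ℕ} (h : j ≤ k) : stage H w j <+: stage H w k := by
  induction k, h using Nat.le_induction with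
  | base => exact List.prefix_rfl
  | succ k _ ih => exact ih.trans (List.prefix_append _ _)

lemma stage_congr {w' : ℕ → List ℕ} {k : ℕ} (h : ∀ j < k, w j = w' j) :
    stage H w k = stage H w' k := by
  induction k with
  | zero => rfl
  | succ k ih => simp only [stage, ih fun j hj => h j (by omega), h k (by omega)]

lemma le_length_stage (hw : ∀ k, ∃ l, w k = 2 :: l) (k : ℕ) : k ≤ (stage H w k).length := by
  induction k with
  | zero => exact Nat.zero_le _
  | succ k ih =>
    obtain ⟨l, hl⟩ := hw k
    simp only [stage, hl, List.length_append, List.length_cons]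
    omega

lemma getD_of_prefix {l l' : List ℕ} (h : l <+: l') {i : ℕ} (hi : i < l.length) :
    l'.getD i 0 = l.getD i 0 := by
  obtain ⟨t, rfl⟩ := h
  exact List.getD_append _ _ _ _ hi

lemma digitSeq_eq (hw : ∀ k, ∃ l, w k = 2 :: l) {k i : ℕ} (hi : i < (stage H w k).length) :
    digitSeq H w i = (stage H w k).getD i 0 := by
  have hi' : i < (stage H w (i + 1)).length := le_length_stage hw (i + 1)
  rcases le_total k (i + 1) with h | h
  · exact getD_of_prefix (stage_prefix h) hi
  · exact (getD_of_prefix (stage_prefix h) hi').symm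

lemma map_digitSeq (hw : ∀ k, ∃ l, w k = 2 :: l) (k : ℕ) :
    (List.range (stage H w k).length).map (digitSeq H w) = stage H w k := by
  refine List.ext_getElem (by simp) fun i h1 h2 => ?_
  rw [List.getElem_map, List.getElem_range, digitSeq_eq hw h2]
  exact (List.getElem_eq_getD 0).symm

lemma seqRow_digitSeq (hw : ∀ k, ∃ l, w k = 2 :: l) (k : ℕ) :
    seqRow (digitSeq H w) (stage H w k).length = wordRow (stage H w k) (0, 1) := by
  rw [seqRow, map_digitSeq hw]

lemma two_le_of_mem_insertion {k n d : ℕ} (hd : d ∈ insertion H k n) : 2 ≤ d := by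
  unfold insertion at hd
  split_ifs at hd
  · simp at hd; omega
  · simp at hd

lemma digitSeq_mem (hw : ∀ k, ∃ l, w k = 2 :: l) (i : ℕ) :
    digitSeq H w i ∈ stage H w (i + 1) := by
  have hi' : i < (stage H w (i + 1)).length := le_length_stage hw (i + 1)
  rw [digitSeq, List.getD_eq_getElem _ _ hi']
  exact List.getElem_mem _

lemma two_le_digitSeq (hw : ∀ k, ∃ l, w k = 2 :: l) (hw2 : ∀ k, ∀ d ∈ w k, 2 ≤ d) (i : ℕ) :
    2 ≤ digitSeq H w i := by
  have h : ∀ k, ∀ d ∈ stage H w k, 2 ≤ d := by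
    intro k
    induction k with
    | zero => simp [stage]
    | succ k ih =>
      intro d hd
      simp only [stage, List.mem_append] at hd
      rcases hd with h | h | h
      · exact ih d h
      · exact two_le_of_mem_insertion h
      · exact hw2 k d h
  exact h _ _ (digitSeq_mem hw i)

lemma exists_insertion_append (hw : ∀ k, ∃ l, w k = 2 :: l) (k n : ℕ) :
    ∃ l, insertion H k n ++ w k = 2 :: l := by
  obtain ⟨l, hl⟩ := hw k
  unfold insertion
  split_ifs
  · exact ⟨_, rfl⟩
  · exact ⟨l, hl⟩

lemma digitSeq_length_stage (hw : ∀ k, ∃ l, w k = 2 :: l) (k : ℕ) :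
    digitSeq H w (stage H w k).length = 2 := by
  obtain ⟨l, hl⟩ := exists_insertion_append (H := H) hw k (stage H w k).length
  have hs : stage H w (k + 1) = stage H w k ++ 2 :: l := by rw [stage, hl]
  have h : (stage H w k).length < (stage H w (k + 1)).length := by
    rw [hs]; simp
  rw [digitSeq_eq hw h, hs]
  simp

lemma wordRow_insertion (k n : ℕ) (v : ℕ × ℕ) (hv : v.1 ≤ v.2) :
    (wordRow (insertion H k n) v).1 ≤ (wordRow (insertion H k n) v).2 ∧
    (wordRow (insertion H k n) v).2 * 2 ^ (Nat.sqrt k) ^ 2 ≤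
      v.2 * 2 ^ (Nat.sqrt (k + 1)) ^ 2 := by
  have hmono : Nat.sqrt k ≤ Nat.sqrt (k + 1) := Nat.sqrt_le_sqrt (Nat.le_succ k)
  unfold insertion
  split_ifs with h
  · obtain ⟨h1, h2⟩ := h
    set N := max 3 (H n) with hN
    have hN3 : 3 ≤ N := le_max_left _ _
    obtain ⟨M, hM⟩ : ∃ M, N = M + 2 := ⟨N - 2, by omega⟩
    have hM1 : 1 ≤ M := by omega
    simp only [wordRow_cons, wordRow_nil, digitRow, hM, Nat.add_sub_cancel,
      show M + 2 - 1 = M + 1 by omega, Nat.sub_self, mul_zero, zero_add, Nat.reduceSub, mul_one]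
    refine ⟨by nlinarith, ?_⟩
    have h3 : Nat.sqrt k + 1 ≤ Nat.sqrt (k + 1) := by omega
    have h4 : (v.1 + v.2) * M + v.2 * (M + 1) ≤ v.2 * (3 * N) := by
      rw [hM]; nlinarith
    calc _ ≤ v.2 * (3 * N) * 2 ^ (Nat.sqrt k) ^ 2 := Nat.mul_le_mul_right _ h4
      _ ≤ v.2 * 2 ^ (2 * Nat.sqrt k + 1) * 2 ^ (Nat.sqrt k) ^ 2 := by gcongr
      _ = v.2 * 2 ^ (Nat.sqrt k + 1) ^ 2 := by rw [mul_assoc, ← pow_add]; congr 2; ring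
      _ ≤ _ := by gcongr; norm_num
  · refine ⟨by simpa using hv, ?_⟩
    simp only [wordRow_nil]
    gcongr
    norm_num

lemma wordRow_stage_fst_le (hrow : ∀ k v, (wordRow (w k) v).1 ≤ (wordRow (w k) v).2) (k : ℕ) :
    (wordRow (stage H w k) (0, 1)).1 ≤ (wordRow (stage H w k) (0, 1)).2 := by
  cases k with
  | zero => simp [stage]
  | succ k => simp only [stage, wordRow_append]; exact hrow _ _

lemma wordRow_stage_snd_le {D : ℕ}
    (hrow : ∀ k v, (wordRow (w k) v).1 ≤ (wordRow (w k) v).2)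
    (hD : ∀ k, (wordRow (w k) (0, 1)).2 ≤ D) (k : ℕ) :
    (wordRow (stage H w k) (0, 1)).2 ≤ (4 * D) ^ k := by
  have h : (wordRow (stage H w k) (0, 1)).2 ≤ (2 * D) ^ k * 2 ^ (Nat.sqrt k) ^ 2 := by
    induction k with
    | zero => simp [stage]
    | succ k ih =>
      simp only [stage, wordRow_append]
      set v := wordRow (stage H w k) (0, 1) with hv
      obtain ⟨h1, h2⟩ := wordRow_insertion (H := H) k (stage H w k).length v
        (wordRow_stage_fst_le hrow k)
      set u := wordRow (insertion H k (stage H w k).length) v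
      have h3 : u.2 ≤ (2 * D) ^ k * 2 ^ (Nat.sqrt (k + 1)) ^ 2 := by
        refine Nat.le_of_mul_le_mul_right (h2.trans ?_)
          (show 0 < 2 ^ (Nat.sqrt k) ^ 2 by positivity)
        calc v.2 * 2 ^ (Nat.sqrt (k + 1)) ^ 2
            ≤ (2 * D) ^ k * 2 ^ (Nat.sqrt k) ^ 2 * 2 ^ (Nat.sqrt (k + 1)) ^ 2 := by gcongr
          _ = _ := by ring
      calc (wordRow (w k) u).2 ≤ 2 * u.2 * (wordRow (w k) (0, 1)).2 := wordRow_snd_le _ _ h1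
        _ ≤ 2 * ((2 * D) ^ k * 2 ^ (Nat.sqrt (k + 1)) ^ 2) * D := by gcongr; exact hD k
        _ = _ := by ring
  refine h.trans ?_
  calc (2 * D) ^ k * 2 ^ (Nat.sqrt k) ^ 2 ≤ (2 * D) ^ k * 2 ^ k := by
        gcongr
        · norm_num
        · exact Nat.sqrt_le' k
    _ = (4 * D) ^ k := by rw [← mul_pow]; congr 1; ring

end Stage

/-- The points coded by two sequences of blocks which first differ at time `k` are not too
close. -/
lemma one_div_le_abs_value_digitSeq_sub {H : ℕ → ℕ} {w w' : ℕ → List ℕ} {D k : ℕ}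
    (hw : ∀ k, ∃ l, w k = 2 :: l) (hw' : ∀ k, ∃ l, w' k = 2 :: l)
    (hw2 : ∀ k, ∀ d ∈ w k, 2 ≤ d) (hw2' : ∀ k, ∀ d ∈ w' k, 2 ≤ d)
    (hrow : ∀ k v, (wordRow (w k) v).1 ≤ (wordRow (w k) v).2)
    (hrow' : ∀ k v, (wordRow (w' k) v).1 ≤ (wordRow (w' k) v).2)
    (hD : ∀ k, (wordRow (w k) (0, 1)).2 ≤ D) (hD' : ∀ k, (wordRow (w' k) (0, 1)).2 ≤ D)
    (hagree : ∀ j < k, w j = w' j) (hne : ¬ w k <+: w' k) (hne' : ¬ w' k <+: w k) :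
    1 / (8 * (((4 * D) ^ (k + 1) : ℕ) : ℝ) ^ 2) ≤
      |value (digitSeq H w) - value (digitSeq H w')| := by
  refine one_div_le_abs_value_sub (two_le_digitSeq hw hw2) (two_le_digitSeq hw' hw2')
    (n := (stage H w (k + 1)).length) (n' := (stage H w' (k + 1)).length) ?_ ?_ ?_
    (digitSeq_length_stage hw _) ?_ ?_ (digitSeq_length_stage hw' _)
  · by_contra! hcon
    have hpre : ∀ l l' : List ℕ, l.length ≤ l'.length →
        (∀ i < l.length, l.getD i 0 = l'.getD i 0) → l <+: l' := by
      intro l l' hl h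
      rw [List.prefix_iff_eq_take]
      refine List.ext_getElem (by simp [hl]) fun i h1 h2 => ?_
      have := h i h1
      rw [List.getD_eq_getElem _ _ h1, List.getD_eq_getElem _ _ (by omega)] at this
      simpa using this
    have hst := stage_congr (H := H) hagree
    rcases le_total (stage H w (k + 1)).length (stage H w' (k + 1)).length with h | h
    · have := hpre _ _ h fun i hi => by
        rw [← digitSeq_eq hw hi, ← digitSeq_eq hw' (by omega)]
        exact hcon i hi (by omega)
      simp only [stage, hst, List.prefix_append_right_inj] at this
      exact hne this
    · have := hpre _ _ h fun i hi => by
        rw [← digitSeq_eq hw' hi, ← digitSeq_eq hw (by omega)]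
        exact (hcon i (by omega) hi).symm
      simp only [stage, hst, List.prefix_append_right_inj] at this
      exact hne' this
  · rw [seqRow_digitSeq hw]; exact wordRow_stage_fst_le hrow _
  · rw [seqRow_digitSeq hw]; exact wordRow_stage_snd_le hrow hD _
  · rw [seqRow_digitSeq hw']; exact wordRow_stage_fst_le hrow' _
  · rw [seqRow_digitSeq hw']; exact wordRow_stage_snd_le hrow' hD' (k + 1)

/-- A lower bound for the Hausdorff dimension of a set coded by a full shift. -/
lemma le_dimH_range_of_separated {b : ℕ} (hb : 1 < b) (X : (ℕ → Fin b) → ℝ) {κ θ : ℝ} {t : ℝ≥0}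
    (hκ : 0 < κ) (hθ : 0 < θ) (ht : 0 < t) (hbθ : (b : ℝ)⁻¹ ≤ θ ^ (t : ℝ))
    (hX : ∀ c c' : ℕ → Fin b, ∀ k, (∀ j < k, c j = c' j) → c k ≠ c' k →
      κ * θ ^ k ≤ |X c - X c'|) :
    (t : ℝ≥0∞) ≤ dimH (range X) := by
  have hdiff : ∀ c c' : ℕ → Fin b, c ≠ c' → ∃ k, (∀ j < k, c j = c' j) ∧ c k ≠ c' k := by
    intro c c' hne
    have hex : ∃ k, c k ≠ c' k := Function.ne_iff.mp hne
    exact ⟨Nat.find hex, fun j hj => not_not.mp (Nat.find_min hex hj), Nat.find_spec hex⟩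
  have hinj : Function.Injective X := by
    intro c c' h
    by_contra hne
    obtain ⟨k, h1, h2⟩ := hdiff c c' hne
    have h3 := hX c c' k h1 h2
    rw [h, sub_self, abs_zero] at h3
    have : 0 < κ * θ ^ k := by positivity
    linarith
  have : Nonempty (Fin b) := ⟨⟨0, by omega⟩⟩
  let g : ℝ → ℝ := fun y => Real.ofDigits (Function.invFun X y)
  have hg : ∀ c, g (X c) = Real.ofDigits c := fun c => by
    simp only [g, Function.leftInverse_invFun hinj c]
  have hholder : HolderOnWith (Real.toNNReal (κ⁻¹ ^ (t : ℝ))) t g (range X) := by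
    rintro _ ⟨c, rfl⟩ _ ⟨c', rfl⟩
    rw [hg, hg]
    by_cases hne : c = c'
    · simp [hne]
    · obtain ⟨k, h1, h2⟩ := hdiff c c' hne
      have h3 := hX c c' k h1 h2
      have h4 : |Real.ofDigits c - Real.ofDigits c'| ≤ κ⁻¹ ^ (t : ℝ) * |X c - X c'| ^ (t : ℝ) := by
        calc |Real.ofDigits c - Real.ofDigits c'| ≤ ((b : ℝ) ^ k)⁻¹ :=
              Real.abs_ofDigits_sub_ofDigits_le h1
          _ = ((b : ℝ)⁻¹) ^ k := by rw [inv_pow]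
          _ ≤ (θ ^ (t : ℝ)) ^ k := by gcongr
          _ = (θ ^ k) ^ (t : ℝ) := by
            rw [← Real.rpow_natCast, ← Real.rpow_mul hθ.le, mul_comm, Real.rpow_mul hθ.le,
              Real.rpow_natCast]
          _ = (κ⁻¹ * (κ * θ ^ k)) ^ (t : ℝ) := by rw [inv_mul_cancel_left₀ hκ.ne']
          _ ≤ (κ⁻¹ * |X c - X c'|) ^ (t : ℝ) := by gcongr
          _ = _ := Real.mul_rpow (by positivity) (abs_nonneg _)
      rw [edist_dist, edist_dist, Real.dist_eq, Real.dist_eq,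
        ENNReal.ofReal_rpow_of_nonneg (abs_nonneg _) t.coe_nonneg]
      change _ ≤ ENNReal.ofReal _ * _
      rw [← ENNReal.ofReal_mul (by positivity)]
      exact ENNReal.ofReal_le_ofReal h4
  have h1 : dimH (Icc (0 : ℝ) 1) = 1 := by
    rw [Real.dimH_of_nonempty_interior (by rw [interior_Icc]; exact ⟨1 / 2, by norm_num⟩)]
    simp
  have h2 : Icc (0 : ℝ) 1 ⊆ g '' range X := by
    intro y hy
    obtain ⟨c, -, hc⟩ := Real.ofDigits_SurjOn hb hy
    exact ⟨X c, ⟨c, rfl⟩, by rw [hg, hc]⟩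
  have h3 : 1 ≤ dimH (range X) / t := h1 ▸ (dimH_mono h2).trans (hholder.dimH_image_le ht)
  rwa [ENNReal.le_div_iff_mul_le (Or.inl (by exact_mod_cast ht.ne')) (Or.inl ENNReal.coe_ne_top),
    one_mul] at h3

/-- For every `t < 1` there is a finite family of blocks such that, whatever digits are inserted,
the set of points coded by sequences of these blocks has dimension at least `t`. -/
lemma exists_blocks_le_dimH {t : ℝ≥0} (ht : 0 < t) (ht1 : t < 1) :
    ∃ (b : ℕ) (W : Fin b → List ℕ), (∀ i, ∀ d ∈ W i, 2 ≤ d) ∧ (∀ i, ∃ l, W i = 2 :: l) ∧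
      ∀ H : ℕ → ℕ, (t : ℝ≥0∞) ≤
        dimH (range fun c : ℕ → Fin b => value (digitSeq H fun k => W (c k))) := by
  have ht1' : (t : ℝ) < 1 := by exact_mod_cast ht1
  obtain ⟨Q, hQ4, hQ⟩ : ∃ Q : ℕ, 5 ≤ Q ∧
      (16 * 56 ^ (2 * (t : ℝ)) : ℝ) ≤ (Q : ℝ) ^ (2 - 2 * (t : ℝ)) := by
    have h := (tendsto_rpow_atTop (show 0 < 2 - 2 * (t : ℝ) by linarith)).comp
      (tendsto_natCast_atTop_atTop (R := ℝ))
    obtain ⟨Q, h1, h2⟩ := ((h.eventually_ge_atTop (16 * 56 ^ (2 * (t : ℝ)))).and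
      (eventually_ge_atTop 5)).exists
    exact ⟨Q, h2, h1⟩
  obtain ⟨b, W, hb, hW2, hWD, hWrow, hWpre, hWhead⟩ := exists_blocks Q
  refine ⟨b, W, hW2, hWhead, fun H => ?_⟩
  have hQpos : (0 : ℝ) < Q := by exact_mod_cast (by omega : 0 < Q)
  refine le_dimH_range_of_separated (κ := 1 / (8 * (56 * (Q : ℝ)) ^ 2))
    (θ := 1 / (56 * (Q : ℝ)) ^ 2) (by nlinarith) _ (by positivity) (by positivity) ht ?_ ?_
  · have h1 : (56 * (Q : ℝ)) ^ (2 * (t : ℝ)) ≤ b := by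
      have h2 : (Q : ℝ) ^ 2 = Q ^ (2 - 2 * (t : ℝ)) * Q ^ (2 * (t : ℝ)) := by
        rw [← Real.rpow_add hQpos, ← Real.rpow_natCast]; congr 1; push_cast; ring
      have h3 : (Q : ℝ) ^ 2 ≤ 16 * b := by exact_mod_cast hb
      rw [Real.mul_rpow (by norm_num) hQpos.le]
      have h4 := mul_le_mul_of_nonneg_right hQ (show 0 ≤ (Q : ℝ) ^ (2 * (t : ℝ)) by positivity)
      nlinarith
    rw [one_div, ← Real.rpow_natCast, Real.inv_rpow (by positivity),
      ← Real.rpow_mul (by positivity)]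
    exact inv_anti₀ (by positivity) (by exact_mod_cast h1)
  · intro c c' k hagree hne
    have h := one_div_le_abs_value_digitSeq_sub (H := H) (w := fun k => W (c k))
      (w' := fun k => W (c' k)) (D := 14 * Q) (k := k) (fun _ => hWhead _) (fun _ => hWhead _)
      (fun _ => hW2 _) (fun _ => hW2 _) (fun _ => hWrow _) (fun _ => hWrow _) (fun _ => hWD _)
      (fun _ => hWD _) (fun j hj => by rw [hagree j hj]) (fun h => hne (hWpre _ _ h))
      (fun h => hne (hWpre _ _ h).symm)
    refine le_trans (le_of_eq ?_) h
    push_cast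
    rw [show (4 * (14 * (Q : ℝ))) = 56 * Q by ring]
    generalize 56 * (Q : ℝ) = z
    rw [one_div_pow, one_div_mul_one_div]
    congr 1
    ring

section Growth

variable {H : ℕ → ℕ} {w : ℕ → List ℕ}

lemma digitSeq_le (hw : ∀ k, ∃ l, w k = 2 :: l) (hH : Monotone H) {B : ℕ} (hB3 : 3 ≤ B)
    (hB : ∀ k, ∀ d ∈ w k, d ≤ B) (i : ℕ) : digitSeq H w i ≤ max B (H i) := by
  have h : ∀ k i, i < (stage H w k).length → (stage H w k).getD i 0 ≤ max B (H i) := by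
    intro k
    induction k with
    | zero => intro i hi; simp [stage] at hi
    | succ k ih =>
      intro i hi
      rcases lt_or_ge i (stage H w k).length with h | h
      · rw [getD_of_prefix (stage_prefix (Nat.le_succ k)) h]
        exact ih i h
      · simp only [stage, List.length_append] at hi ⊢
        rw [List.getD_append_right _ _ _ _ h, List.getD_eq_getElem _ _ (by simp; omega)]
        have hmem := List.getElem_mem
          (l := insertion H k (stage H w k).length ++ w k) (n := i - (stage H w k).length)
          (by simp; omega)
        rcases List.mem_append.1 hmem with h1 | h1
        · have hHi := hH h
          unfold insertion at h1 ⊢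
          split_ifs at h1 ⊢ with h2
          · rw [List.mem_cons, List.mem_singleton] at h1
            omega
          · simp at h1
        · exact (hB k _ h1).trans (le_max_left _ _)
  exact h _ _ (le_length_stage hw (i + 1))

lemma length_stage_add_le {L : ℕ} (hL : ∀ k, (w k).length + 2 ≤ L) (k d : ℕ) :
    (stage H w (k + d)).length ≤ (stage H w k).length + L * d := by
  induction d with
  | zero => simp
  | succ d ih =>
    have h1 : (insertion H (k + d) (stage H w (k + d)).length).length ≤ 2 := by
      unfold insertion
      split_ifs <;> simp
    have h2 := hL (k + d)
    rw [← add_assoc, stage, List.length_append, List.length_append, mul_add, mul_one]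
    omega

lemma eventually_insertion_cost_le (C L : ℕ) :
    ∀ᶠ j : ℕ in atTop, 3 * max 3 (C * (L * j ^ 2) + C) ≤ 2 ^ (2 * (j - 1) + 1) := by
  have h := tendsto_pow_const_div_const_pow_of_one_lt 2 (show (1 : ℝ) < 2 by norm_num)
  have hA : (0 : ℝ) < 1 / (9 + 3 * (C * L) + 3 * C) := by positivity
  filter_upwards [h.eventually_lt_const hA, eventually_ge_atTop 1] with j hj hj1
  rw [div_lt_div_iff₀ (by positivity) (by positivity), one_mul] at hj
  have hj' : j ^ 2 * (9 + 3 * (C * L) + 3 * C) < 2 ^ j := by exact_mod_cast hj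
  have h1 : 2 ^ j ≤ 2 ^ (2 * (j - 1) + 1) := Nat.pow_le_pow_right (by norm_num) (by omega)
  have h2 : 1 ≤ j ^ 2 := Nat.one_le_pow _ _ hj1
  have h3 : C ≤ C * j ^ 2 := Nat.le_mul_of_pos_right C h2
  have h4 : j ^ 2 * (9 + 3 * (C * L) + 3 * C) =
      9 * j ^ 2 + 3 * (C * (L * j ^ 2)) + 3 * (C * j ^ 2) := by ring
  omega

lemma eventually_exists_le_sup_digitSeq (hw : ∀ k, ∃ l, w k = 2 :: l) {L C : ℕ}
    (hL : ∀ k, (w k).length + 2 ≤ L) (hC : ∀ n, H n ≤ C * n + C) :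
    ∀ᶠ m : ℕ in atTop, ∃ g, g ≤ m ∧ m ≤ g + L * (2 * Nat.sqrt m + 2) ∧
      H g ≤ (Finset.range m).sup (digitSeq H w) := by
  obtain ⟨J, hJ⟩ := eventually_atTop.1 (eventually_insertion_cost_le C L)
  have hlen : ∀ k, (stage H w k).length ≤ L * k := fun k => by
    simpa [stage] using length_stage_add_le (H := H) hL 0 k
  filter_upwards [eventually_ge_atTop (L * ((J + 1) ^ 2 + 1))] with m hm
  set K := Nat.findGreatest (fun k => (stage H w k).length ≤ m) m with hK
  have hKm : (stage H w K).length ≤ m :=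
    Nat.findGreatest_spec (P := fun k => (stage H w k).length ≤ m) (Nat.zero_le m) (by simp [stage])
  have hKm' : m < (stage H w (K + 1)).length := by
    by_contra! hcon
    have h1 : K + 1 ≤ m := (le_length_stage hw (K + 1)).trans hcon
    have h2 := Nat.le_findGreatest (P := fun k => (stage H w k).length ≤ m) h1 hcon
    omega
  have hKJ : (J + 1) ^ 2 ≤ K := by
    have h1 := hm.trans_lt (hKm'.trans_le (hlen (K + 1)))
    have h2 := lt_of_mul_lt_mul_left h1 (Nat.zero_le L)
    omega
  obtain ⟨i, hi⟩ : ∃ i, Nat.sqrt K = i + 1 := by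
    have h1 : J + 1 ≤ Nat.sqrt K := Nat.le_sqrt'.2 hKJ
    exact ⟨Nat.sqrt K - 1, by omega⟩
  have hiJ : J ≤ i + 1 := by
    have h1 : J + 1 ≤ Nat.sqrt K := Nat.le_sqrt'.2 hKJ
    omega
  have hiK : (i + 1) ^ 2 ≤ K := hi ▸ Nat.sqrt_le' K
  have hiK' : K < (i + 1 + 1) ^ 2 := hi ▸ Nat.lt_succ_sqrt' K
  have him : i + 1 ≤ Nat.sqrt m := by
    rw [← hi]
    exact Nat.sqrt_le_sqrt ((le_length_stage hw K).trans hKm)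
  obtain ⟨k, hk⟩ : ∃ k, k + 1 = (i + 1) ^ 2 := ⟨i ^ 2 + 2 * i, by ring⟩
  have hsk1 : Nat.sqrt (k + 1) = i + 1 := by rw [hk, Nat.sqrt_eq']
  have hsk : Nat.sqrt k = i := by
    refine (Nat.eq_sqrt'.2 ⟨?_, ?_⟩).symm <;> nlinarith
  have hins : insertion H k (stage H w k).length = [2, max 3 (H (stage H w k).length)] := by
    rw [insertion, if_pos]
    refine ⟨by omega, ?_⟩
    rw [hsk]
    refine le_trans ?_ (hJ (i + 1) hiJ)
    have h1 : (stage H w k).length ≤ L * (i + 1) ^ 2 := by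
      rw [← hk]
      exact (hlen k).trans (Nat.mul_le_mul_left _ (Nat.le_succ k))
    have h2 := (hC (stage H w k).length).trans
      (Nat.add_le_add_right (Nat.mul_le_mul_left C h1) C)
    gcongr
  have hst : stage H w (k + 1) =
      stage H w k ++ ([2, max 3 (H (stage H w k).length)] ++ w k) := by
    rw [stage, hins]
  have hlt : (stage H w k).length + 1 < (stage H w (k + 1)).length := by
    rw [hst]; simp
  have hle : (stage H w (k + 1)).length ≤ m :=
    (stage_prefix (by omega : k + 1 ≤ K)).length_le.trans hKm
  refine ⟨(stage H w k).length, by omega, ?_, ?_⟩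
  · obtain ⟨d, hd⟩ : ∃ d, K + 1 = k + d := ⟨K + 1 - k, by omega⟩
    have h1 := length_stage_add_le (H := H) hL k d
    rw [← hd] at h1
    have h2 : d ≤ 2 * Nat.sqrt m + 2 := by nlinarith
    have h3 := Nat.mul_le_mul_left L h2
    omega
  · have h1 : digitSeq H w ((stage H w k).length + 1) = max 3 (H (stage H w k).length) := by
      rw [digitSeq_eq hw hlt, hst, List.getD_append_right _ _ _ _ (by omega)]
      simp
    have h2 := Finset.le_sup (f := digitSeq H w)
      (Finset.mem_range.2 (show (stage H w k).length + 1 < m by omega))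
    omega

end Growth

lemma eventually_one_le_log_log : ∀ᶠ m : ℕ in atTop, 1 ≤ Real.log (Real.log m) :=
  (Real.tendsto_log_atTop.comp (Real.tendsto_log_atTop.comp
    (tendsto_natCast_atTop_atTop (R := ℝ)))).eventually_ge_atTop 1

lemma tendsto_log_log_div : Tendsto (fun m : ℕ => Real.log (Real.log m) / m) atTop (𝓝 0) := by
  have h : Tendsto (fun m : ℕ => Real.log m / m) atTop (𝓝 0) := by
    have h1 := Real.isLittleO_log_id_atTop.tendsto_div_nhds_zero
    exact h1.comp (tendsto_natCast_atTop_atTop (R := ℝ))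
  refine squeeze_zero' ?_ ?_ h
  · filter_upwards [eventually_one_le_log_log] with m hm
    exact div_nonneg (by linarith) (Nat.cast_nonneg m)
  · filter_upwards [eventually_ge_atTop 2] with m hm
    have : 0 < Real.log m := Real.log_pos (by exact_mod_cast hm)
    refine div_le_div_of_nonneg_right ?_ (Nat.cast_nonneg m)
    linarith [Real.log_le_sub_one_of_pos this]

lemma tendsto_div_of_le_add_mul_sqrt {g : ℕ → ℕ} {L : ℕ} (hg : ∀ᶠ m in atTop, g m ≤ m)
    (hg' : ∀ᶠ m in atTop, m ≤ g m + L * (2 * Nat.sqrt m + 2)) :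
    Tendsto (fun m => (g m : ℝ) / m) atTop (𝓝 1) := by
  have h1 : Tendsto (fun m : ℕ => 1 - 4 * L / √(m : ℝ)) atTop (𝓝 1) := by
    have h := (Real.tendsto_sqrt_atTop.comp (tendsto_natCast_atTop_atTop (R := ℝ))).const_div_atTop
      (4 * (L : ℝ))
    simpa using h.const_sub 1
  refine tendsto_of_tendsto_of_tendsto_of_le_of_le' h1 tendsto_const_nhds ?_ ?_
  · filter_upwards [hg', eventually_ge_atTop 1] with m hm hm1
    have hm1' : (1 : ℝ) ≤ m := by exact_mod_cast hm1
    have h2 : (m : ℝ) ≤ g m + L * (2 * Nat.sqrt m + 2) := by exact_mod_cast hm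
    have h3 : (Nat.sqrt m : ℝ) ≤ √(m : ℝ) := Real.nat_sqrt_le_real_sqrt
    have h4 : 1 ≤ √(m : ℝ) := Real.one_le_sqrt.2 hm1'
    have h5 : √(m : ℝ) * √(m : ℝ) = m := Real.mul_self_sqrt (by positivity)
    have h6 : 4 * (L : ℝ) / √(m : ℝ) = 4 * L * √(m : ℝ) / m := by
      rw [div_eq_div_iff (by positivity) (by positivity), mul_assoc (4 * (L : ℝ)), h5]
    rw [h6, le_div_iff₀ (by positivity), sub_mul, div_mul_cancel₀ _ (by positivity)]
    have h7 : (L : ℝ) * (2 * Nat.sqrt m + 2) ≤ L * (4 * √(m : ℝ)) := by gcongr; linarith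
    linarith
  · filter_upwards [hg, eventually_ge_atTop 1] with m hm hm1
    have hm1' : (0 : ℝ) < m := by exact_mod_cast hm1
    rw [div_le_one hm1']
    exact_mod_cast hm

/-- The growth rate of the largest digit is determined by the inserted digits. -/
lemma exists_tendsto_mul_le_ratio {H : ℕ → ℕ} {w : ℕ → List ℕ} (hw : ∀ k, ∃ l, w k = 2 :: l)
    {L C : ℕ} (hL : ∀ k, (w k).length + 2 ≤ L) (hC : ∀ n, H n ≤ C * n + C) :
    ∃ g : ℕ → ℕ, Tendsto g atTop atTop ∧ Tendsto (fun m => (g m : ℝ) / m) atTop (𝓝 1) ∧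
      ∀ᶠ m in atTop, H (g m) * Real.log (Real.log (g m)) / g m * ((g m : ℝ) / m) ≤
        ratio (digitSeq H w) m := by
  obtain ⟨g, hg⟩ := (eventually_exists_le_sup_digitSeq hw hL hC).choice
  have hdiv := tendsto_div_of_le_add_mul_sqrt (hg.mono fun _ h => h.1) (hg.mono fun _ h => h.2.1)
  have hgt : Tendsto g atTop atTop := by
    refine tendsto_natCast_atTop_iff (R := ℝ).1 ?_
    refine (hdiv.pos_mul_atTop one_pos (tendsto_natCast_atTop_atTop (R := ℝ))).congr' ?_
    filter_upwards [eventually_ge_atTop 1] with m hm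
    have : (0 : ℝ) < m := by exact_mod_cast hm
    exact div_mul_cancel₀ _ this.ne'
  refine ⟨g, hgt, hdiv, ?_⟩
  filter_upwards [hg, hgt.eventually (eventually_ge_atTop 3), hgt.eventually
    eventually_one_le_log_log] with m hm hg3 hlog
  have hg0 : (3 : ℝ) ≤ g m := by exact_mod_cast hg3
  have hgm : (g m : ℝ) ≤ m := by exact_mod_cast hm.1
  have hlg : 0 < Real.log (g m) := Real.log_pos (by linarith)
  rw [div_mul_div_cancel₀ (by linarith), ratio]
  gcongr
  exact hm.2.2

lemma tendsto_ratio_nhds {H : ℕ → ℕ} {w : ℕ → List ℕ} (hw : ∀ k, ∃ l, w k = 2 :: l)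
    (hH : Monotone H) {L C B : ℕ} (hL : ∀ k, (w k).length + 2 ≤ L) (hC : ∀ n, H n ≤ C * n + C)
    (hB : ∀ k, ∀ d ∈ w k, d ≤ B) {x : ℝ} (hx : 0 ≤ x)
    (h : Tendsto (fun n : ℕ => H n * Real.log (Real.log n) / n) atTop (𝓝 x)) :
    Tendsto (ratio (digitSeq H w)) atTop (𝓝 x) := by
  obtain ⟨g, hg, hdiv, hle⟩ := exists_tendsto_mul_le_ratio hw hL hC
  have h1 := (h.comp hg).mul hdiv
  rw [mul_one] at h1
  have h2 := (tendsto_log_log_div.const_mul ((max B 3 : ℕ) : ℝ)).max h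
  rw [mul_zero, max_eq_right hx] at h2
  refine tendsto_of_tendsto_of_tendsto_of_le_of_le' h1 h2 hle ?_
  filter_upwards [eventually_one_le_log_log] with m hm
  have hsup : (Finset.range m).sup (digitSeq H w) ≤ max (max B 3) (H m) :=
    Finset.sup_le fun i hi => (digitSeq_le hw hH (le_max_right B 3)
      (fun k d hd => (hB k d hd).trans (le_max_left _ _)) i).trans
        (max_le_max le_rfl (hH (Finset.mem_range.1 hi).le))
  have hll : 0 ≤ Real.log (Real.log m) / m := div_nonneg (by linarith) (Nat.cast_nonneg m)
  rw [ratio, mul_div_assoc, mul_div_assoc, ← max_mul_of_nonneg _ _ hll]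
  gcongr
  exact_mod_cast hsup

lemma tendsto_ratio_atTop {H : ℕ → ℕ} {w : ℕ → List ℕ} (hw : ∀ k, ∃ l, w k = 2 :: l)
    {L C : ℕ} (hL : ∀ k, (w k).length + 2 ≤ L) (hC : ∀ n, H n ≤ C * n + C)
    (h : Tendsto (fun n : ℕ => H n * Real.log (Real.log n) / n) atTop atTop) :
    Tendsto (ratio (digitSeq H w)) atTop atTop := by
  obtain ⟨g, hg, hdiv, hle⟩ := exists_tendsto_mul_le_ratio hw hL hC
  exact tendsto_atTop_mono' _ hle ((h.comp hg).atTop_mul_pos one_pos hdiv)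

lemma one_le_log_of_three_le {x : ℝ} (hx : 3 ≤ x) : 1 ≤ Real.log x :=
  (Real.le_log_iff_exp_le (by linarith)).2 (Real.exp_one_lt_three.le.trans hx)

lemma three_le_log_of_le {x : ℝ} (hx : 27 ≤ x) : 3 ≤ Real.log x := by
  have h1 : Real.log 27 = 3 * Real.log 3 := by
    rw [show (27 : ℝ) = 3 ^ 3 by norm_num, Real.log_pow]; norm_num
  have h2 := one_le_log_of_three_le (x := 3) le_rfl
  have h3 := Real.log_le_log (by norm_num) hx
  linarith

/-- The function `y ↦ y / log log y` is increasing on `[27, ∞)`. -/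
lemma div_log_log_le {x y : ℝ} (hx : 27 ≤ x) (hxy : x ≤ y) :
    x / Real.log (Real.log x) ≤ y / Real.log (Real.log y) := by
  have he := Real.exp_one_lt_three
  have hlx := three_le_log_of_le hx
  have hly := three_le_log_of_le (hx.trans hxy)
  have hllx := one_le_log_of_three_le hlx
  have hlly := one_le_log_of_three_le hly
  have h1 : Real.log y / y ≤ Real.log x / x :=
    Real.log_div_self_antitoneOn (mem_Ici.2 (by linarith)) (mem_Ici.2 (by linarith)) hxy
  have h2 : Real.log (Real.log y) / Real.log y ≤ Real.log (Real.log x) / Real.log x :=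
    Real.log_div_self_antitoneOn (mem_Ici.2 (by linarith)) (mem_Ici.2 (by linarith))
      (Real.log_le_log (by linarith) hxy)
  have h3 := mul_le_mul h2 h1 (div_nonneg (by linarith) (by linarith))
    (div_nonneg (by linarith) (by linarith))
  rw [div_mul_div_cancel₀ (by linarith), div_mul_div_cancel₀ (by linarith)] at h3
  rw [← inv_div (Real.log (Real.log x)), ← inv_div (Real.log (Real.log y))]
  exact inv_anti₀ (div_pos (by linarith) (by linarith)) h3

lemma tendsto_div_log_log : Tendsto (fun n : ℕ => (n : ℝ) / Real.log (Real.log n)) atTop atTop := by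
  have h : Tendsto (fun n : ℕ => Real.log (Real.log n) / n) atTop (𝓝[>] 0) := by
    refine tendsto_nhdsWithin_iff.2 ⟨tendsto_log_log_div, ?_⟩
    filter_upwards [eventually_one_le_log_log, eventually_ge_atTop 1] with n hn hn1
    have : (0 : ℝ) < n := by exact_mod_cast hn1
    exact div_pos (by linarith) this
  exact h.inv_tendsto_nhdsGT_zero.congr fun n => inv_div _ _

lemma exists_monotone_tendsto {x : ℝ} (hx : 0 ≤ x) :
    ∃ (H : ℕ → ℕ) (C : ℕ), Monotone H ∧ (∀ n, H n ≤ C * n + C) ∧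
      Tendsto (fun n : ℕ => H n * Real.log (Real.log n) / n) atTop (𝓝 x) := by
  refine ⟨fun n => if n < 27 then 0 else ⌊x * (n / Real.log (Real.log n))⌋₊, ⌈x⌉₊, ?_, ?_, ?_⟩
  · intro m n hmn
    dsimp only
    split_ifs with h1 h2 h2
    · exact le_rfl
    · exact Nat.zero_le _
    · omega
    · refine Nat.floor_le_floor (mul_le_mul_of_nonneg_left (div_log_log_le ?_ ?_) hx)
      · exact_mod_cast not_lt.1 h1
      · exact_mod_cast hmn
  · intro n
    dsimp only
    split_ifs with h1
    · exact Nat.zero_le _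
    · have hn : (27 : ℝ) ≤ n := by exact_mod_cast not_lt.1 h1
      have hll := one_le_log_of_three_le (three_le_log_of_le hn)
      refine (Nat.floor_le_of_le ?_).trans (Nat.le_add_right _ _)
      push_cast
      exact mul_le_mul (Nat.le_ceil x) (div_le_self (by linarith) hll)
        (div_nonneg (by linarith) (by linarith)) (Nat.cast_nonneg _)
  · refine ((tendsto_nat_floor_mul_div_atTop hx).comp tendsto_div_log_log).congr' ?_
    filter_upwards [eventually_ge_atTop 27] with n hn
    simp only [Function.comp_apply, if_neg (not_lt.2 hn), div_div_eq_mul_div]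

/-- Every growth rate of the largest digit can be produced by inserting suitable digits. -/
lemma exists_tendsto_ratio {α : EReal} (hα : 0 ≤ α) :
    ∃ H : ℕ → ℕ, ∀ (w : ℕ → List ℕ) (L B : ℕ), (∀ k, ∃ l, w k = 2 :: l) →
      (∀ k, (w k).length + 2 ≤ L) → (∀ k, ∀ d ∈ w k, d ≤ B) →
      Tendsto (fun n => (ratio (digitSeq H w) n : EReal)) atTop (𝓝 α) := by
  induction α using EReal.rec with
  | bot => simp at hα
  | top =>
    refine ⟨id, fun w L B hw hL hB => EReal.tendsto_coe_nhds_top_iff.2 ?_⟩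
    refine tendsto_ratio_atTop (C := 1) hw hL (fun n => by simp) ?_
    refine (Real.tendsto_log_atTop.comp (Real.tendsto_log_atTop.comp
      (tendsto_natCast_atTop_atTop (R := ℝ)))).congr' ?_
    filter_upwards [eventually_ge_atTop 1] with n hn
    have : (0 : ℝ) < n := by exact_mod_cast hn
    simp only [Function.comp_apply, id]
    field_simp
  | coe x =>
    have hx : 0 ≤ x := by exact_mod_cast hα
    obtain ⟨H, C, hH, hC, h⟩ := exists_monotone_tendsto hx
    exact ⟨H, fun w L B hw hL hB => EReal.tendsto_coe.2 (tendsto_ratio_nhds hw hH hL hC hB hx h)⟩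

/-- **Theorem.** For the backward continued fraction, for every `α ∈ [0,∞]` the set of
irrationals `x ∈ (0,1)` with `max{a₁(x),…,a_n(x)} (log log n)/n → α` has Hausdorff
dimension `1`. -/
theorem backward_wu_xu (α : EReal) (hα : 0 ≤ α) :
    dimH {x : ℝ | x ∈ Ioo (0:ℝ) 1 ∧ Irrational x ∧
      ∃ a : ℕ → ℕ, (∀ k, 2 ≤ a k) ∧
        Tendsto (fun n => comp bcf a n 0) atTop (𝓝 x) ∧
        Tendsto (fun n => (ratio a n : EReal)) atTop (𝓝 α)} = 1 := by
  refine le_antisymm ((dimH_mono (subset_univ _)).trans Real.dimH_univ.le) ?_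
  obtain ⟨H, hH⟩ := exists_tendsto_ratio hα
  refine ENNReal.le_of_forall_nnreal_lt fun t ht => ?_
  rcases eq_zero_or_pos t with rfl | ht0
  · simp
  obtain ⟨b, W, hW2, hWhead, hdim⟩ := exists_blocks_le_dimH ht0 (by exact_mod_cast ht)
  have hsub : (range fun c : ℕ → Fin b => value (digitSeq H fun k => W (c k))) ⊆
      {x : ℝ | x ∈ Ioo (0:ℝ) 1 ∧ Irrational x ∧
        ∃ a : ℕ → ℕ, (∀ k, 2 ≤ a k) ∧
          Tendsto (fun n => comp bcf a n 0) atTop (𝓝 x) ∧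
          Tendsto (fun n => (ratio a n : EReal)) atTop (𝓝 α)} ∪ range ((↑) : ℚ → ℝ) := by
    rintro _ ⟨c, rfl⟩
    by_cases hirr : Irrational (value (digitSeq H fun k => W (c k)))
    · have ha := two_le_digitSeq (H := H) (w := fun k => W (c k)) (fun k => hWhead (c k))
        fun k => hW2 (c k)
      have hmem := value_mem ha
      refine Or.inl ⟨⟨hmem.1.lt_of_ne hirr.ne_zero.symm, hmem.2.lt_of_ne hirr.ne_one⟩, hirr, _, ha,
        tendsto_value ha, ?_⟩
      exact hH _ (Finset.univ.sup fun i => (W i).length + 2) (Finset.univ.sup fun i => (W i).sum)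
        (fun k => hWhead (c k))
        (fun k => Finset.le_sup (f := fun i => (W i).length + 2) (Finset.mem_univ (c k)))
        (fun k d hd => (List.le_sum_of_mem hd).trans
          (Finset.le_sup (f := fun i => (W i).sum) (Finset.mem_univ (c k))))
    · exact Or.inr (not_not.1 hirr)
  have h := (hdim H).trans (dimH_mono hsub)
  rwa [dimH_union, dimH_countable (countable_range _), max_eq_left zero_le] at h

end

end ParabolicIFSPaper
end

section
/- Every irrational number x ∈ (0,1) has a unique even-integer continued fraction expansion: there is exactly one pair of sequences {b_n}_{n∈ℕ} of positive even integers and {ε_n}_{n∈ℕ} with ε_n ∈ {1,−1} such that x = 1/(b₁ + ε₁/(b₂ + ε₂/(b₃ + ⋯))), i.e., x is the limit of the finite continued fractions 1/(b₁ + ε₁/(b₂ + ⋯ + ε_{n−1}/b_n)). -/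
open Set Filter Topology

/-- The finite even-integer continued fraction
`1/(b₀ + e₀/(b₁ + ⋯ + e_{n-2}/b_{n-1}))` built from the first `n` digits (0-indexed). -/
noncomputable def evenCF (b : ℕ → ℕ) (e : ℕ → ℤ) (n : ℕ) : ℝ :=
  1 / (((List.range (n - 1)).map fun j => ((b j : ℝ), (e j : ℝ))).foldr
      (fun pe t => pe.1 + pe.2 / t) (b (n - 1) : ℝ))

theorem evenCF_one (b : ℕ → ℕ) (e : ℕ → ℤ) : evenCF b e 1 = 1 / (b 0 : ℝ) := by
  simp [evenCF]

theorem evenCF_add_two (b : ℕ → ℕ) (e : ℕ → ℤ) (n : ℕ) :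
    evenCF b e (n + 2) =
      1 / ((b 0 : ℝ) + e 0 * evenCF (fun k => b (k + 1)) (fun k => e (k + 1)) (n + 1)) := by
  have h : n + 2 - 1 = n + 1 := rfl
  simp only [evenCF, h, Nat.add_sub_cancel, List.range_succ_eq_map, List.map_cons,
    List.foldr_cons, List.map_map, Function.comp_def, Nat.succ_eq_add_one]
  rw [mul_one_div]

/-- The digits of an even-integer continued fraction: positive even integers and signs. -/
def IsEvenDigits (b : ℕ → ℕ) (e : ℕ → ℤ) : Prop :=
  ∀ k, Even (b k) ∧ 0 < b k ∧ (e k = 1 ∨ e k = -1)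

theorem IsEvenDigits.shift {b : ℕ → ℕ} {e : ℕ → ℤ} (h : IsEvenDigits b e) :
    IsEvenDigits (fun k => b (k + 1)) (fun k => e (k + 1)) :=
  fun k => h (k + 1)

theorem IsEvenDigits.two_le {b : ℕ → ℕ} {e : ℕ → ℤ} (h : IsEvenDigits b e) (k : ℕ) :
    (2 : ℝ) ≤ b k := by
  obtain ⟨⟨m, hm⟩, hpos, -⟩ := h k
  exact_mod_cast (by omega : 2 ≤ b k)

theorem IsEvenDigits.evenCF_mem {b : ℕ → ℕ} {e : ℕ → ℤ} (h : IsEvenDigits b e) (n : ℕ) :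
    evenCF b e (n + 1) ∈ Ioo (0 : ℝ) 1 := by
  induction n generalizing b e with
  | zero =>
    have hb := h.two_le 0
    rw [evenCF_one]
    exact ⟨by positivity, by rw [div_lt_one] <;> linarith⟩
  | succ n ih =>
    have hb := h.two_le 0
    obtain ⟨h0, h1⟩ := ih h.shift
    rw [evenCF_add_two]
    set c := evenCF (fun k => b (k + 1)) (fun k => e (k + 1)) (n + 1)
    have hd : 1 < (b 0 : ℝ) + e 0 * c := by
      rcases (h 0).2.2 with he | he <;> rw [he] <;> push_cast <;> linarith
    exact ⟨by positivity, by rw [div_lt_one] <;> linarith⟩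

/-- The branch `t ↦ 1 / (b + ε t)` shrinks a distance `d` to at most `d / (1 + d)`. -/
theorem abs_one_div_sub_le {b ε y z : ℝ} {m : ℝ} (hm : 0 < m) (hb : 2 ≤ b)
    (hε : ε = 1 ∨ ε = -1) (hy : y ∈ Icc (0 : ℝ) 1) (hz : z ∈ Icc (0 : ℝ) 1)
    (hyz : |y - z| ≤ 1 / m) :
    |1 / (b + ε * y) - 1 / (b + ε * z)| ≤ 1 / (m + 1) := by
  obtain ⟨hy0, hy1⟩ := hy
  obtain ⟨hz0, hz1⟩ := hz
  have hY : 2 - y ≤ b + ε * y := by rcases hε with rfl | rfl <;> linarith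
  have hZ : 2 - z ≤ b + ε * z := by rcases hε with rfl | rfl <;> linarith
  have hε1 : |ε| = 1 := by rcases hε with rfl | rfl <;> simp
  have hYp : 0 < b + ε * y := by linarith
  have hZp : 0 < b + ε * z := by linarith
  have key : 1 + |y - z| ≤ (b + ε * y) * (b + ε * z) := by
    refine le_trans ?_ (mul_le_mul hY hZ (by linarith) hYp.le)
    rcases abs_cases (y - z) with ⟨h, -⟩ | ⟨h, -⟩ <;> rw [h] <;> nlinarith
  have hdiff : 1 / (b + ε * y) - 1 / (b + ε * z)
      = ε * (z - y) / ((b + ε * y) * (b + ε * z)) := by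
    field_simp
    ring
  rw [hdiff, abs_div, abs_mul, hε1, one_mul, abs_sub_comm z y,
    abs_of_pos (mul_pos hYp hZp), div_le_div_iff₀ (mul_pos hYp hZp) (by linarith)]
  rw [le_div_iff₀ hm] at hyz
  linarith

/-- Quantitative convergence of an expansion along an orbit in `[0,1]`. -/
theorem IsEvenDigits.abs_evenCF_sub_le {b : ℕ → ℕ} {e : ℕ → ℤ} (h : IsEvenDigits b e)
    {X : ℕ → ℝ} (hX : ∀ k, X k ∈ Icc (0 : ℝ) 1)
    (hstep : ∀ k, X k = 1 / ((b k : ℝ) + e k * X (k + 1))) (n : ℕ) :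
    |evenCF b e (n + 1) - X 0| ≤ 1 / ((n : ℝ) + 1) := by
  induction n generalizing b e X with
  | zero =>
    obtain ⟨h0, h1⟩ := h.evenCF_mem 0
    obtain ⟨h2, h3⟩ := hX 0
    rw [abs_le]
    norm_num at h0 h1 ⊢
    constructor <;> linarith
  | succ n ih =>
    have hi := ih h.shift (X := fun k => X (k + 1)) (fun k => hX _) (fun k => hstep _)
    rw [evenCF_add_two, hstep 0]
    push_cast
    refine abs_one_div_sub_le (by positivity) (h.two_le 0) ?_
      (Ioo_subset_Icc_self (h.shift.evenCF_mem n)) (hX 1) hi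
    rcases (h 0).2.2 with he | he <;> simp [he]

theorem IsEvenDigits.tendsto_evenCF {b : ℕ → ℕ} {e : ℕ → ℤ} (h : IsEvenDigits b e)
    {X : ℕ → ℝ} (hX : ∀ k, X k ∈ Icc (0 : ℝ) 1)
    (hstep : ∀ k, X k = 1 / ((b k : ℝ) + e k * X (k + 1))) :
    Tendsto (fun n => evenCF b e n) atTop (𝓝 (X 0)) := by
  rw [← tendsto_add_atTop_iff_nat 1, tendsto_iff_dist_tendsto_zero]
  exact squeeze_zero (fun _ => dist_nonneg) (h.abs_evenCF_sub_le hX hstep)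
    tendsto_one_div_add_atTop_nhds_zero_nat

/-- The first digits of an irrational number in `(0,1)` and its remainder. -/
theorem exists_even_digit {x : ℝ} (hx : x ∈ Ioo (0 : ℝ) 1) (hirr : Irrational x) :
    ∃ (b : ℕ) (e : ℤ) (y : ℝ), (Even b ∧ 0 < b ∧ (e = 1 ∨ e = -1)) ∧
      (y ∈ Ioo (0 : ℝ) 1 ∧ Irrational y) ∧ x = 1 / ((b : ℝ) + e * y) := by
  obtain ⟨hx0, hx1⟩ := hx
  have hinv : 1 < x⁻¹ := (one_lt_inv₀ hx0).2 hx1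
  have hirr' : Irrational x⁻¹ := hirr.inv
  set m := ⌊x⁻¹⌋₊ with hm
  have hm1 : 1 ≤ m := by rw [hm, Nat.one_le_floor_iff]; exact hinv.le
  have hle : (m : ℝ) ≤ x⁻¹ := Nat.floor_le (by positivity)
  have hlt : x⁻¹ < m + 1 := Nat.lt_floor_add_one _
  have hne : (m : ℝ) ≠ x⁻¹ := (hirr'.ne_nat m).symm
  have hlt' : (m : ℝ) < x⁻¹ := lt_of_le_of_ne hle hne
  rcases Nat.even_or_odd m with hev | hodd
  · refine ⟨m, 1, x⁻¹ - m, ⟨hev, hm1, Or.inl rfl⟩,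
      ⟨⟨by linarith, by linarith⟩, hirr'.sub_natCast m⟩, ?_⟩
    simp
  · refine ⟨m + 1, -1, ((m + 1 : ℕ) : ℝ) - x⁻¹, ⟨hodd.add_one, by omega, Or.inr rfl⟩,
      ⟨⟨by push_cast; linarith, by push_cast; linarith⟩, hirr'.natCast_sub (m + 1)⟩, ?_⟩
    simp

/-- An expansion of an irrational number yields one of its remainder. -/
theorem IsEvenDigits.exists_remainder {b : ℕ → ℕ} {e : ℕ → ℤ} (h : IsEvenDigits b e) {x : ℝ}
    (hirr : Irrational x) (ht : Tendsto (fun n => evenCF b e n) atTop (𝓝 x)) :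
    ∃ y ∈ Ioo (0 : ℝ) 1, Irrational y ∧ x⁻¹ = (b 0 : ℝ) + e 0 * y ∧
      Tendsto (fun n => evenCF (fun k => b (k + 1)) (fun k => e (k + 1)) n) atTop (𝓝 y) := by
  have hee : (e 0 : ℝ) * e 0 = 1 := by rcases (h 0).2.2 with he | he <;> simp [he]
  have hy : Irrational ((e 0 : ℝ) * (x⁻¹ - b 0)) := by
    have := hirr.inv.sub_natCast (b 0)
    rcases (h 0).2.2 with he | he
    · simpa [he] using this
    · simpa [he] using this.neg
  have htail : Tendsto (fun n => evenCF (fun k => b (k + 1)) (fun k => e (k + 1)) n) atTop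
      (𝓝 ((e 0 : ℝ) * (x⁻¹ - b 0))) := by
    rw [← tendsto_add_atTop_iff_nat 1]
    have h2 := (tendsto_add_atTop_iff_nat 2).2 ht
    refine (((h2.inv₀ hirr.ne_zero).sub_const (b 0 : ℝ)).const_mul (e 0 : ℝ)).congr fun n => ?_
    rw [evenCF_add_two, one_div, inv_inv, add_sub_cancel_left, ← mul_assoc, hee, one_mul]
  have hmem : (e 0 : ℝ) * (x⁻¹ - b 0) ∈ Icc (0 : ℝ) 1 :=
    isClosed_Icc.mem_of_tendsto ((tendsto_add_atTop_iff_nat 1).2 htail)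
      (Eventually.of_forall fun n => Ioo_subset_Icc_self (h.shift.evenCF_mem n))
  refine ⟨_, ⟨lt_of_le_of_ne hmem.1 hy.ne_zero.symm, lt_of_le_of_ne hmem.2 hy.ne_one⟩, hy, ?_,
    htail⟩
  rw [← mul_assoc, hee]
  ring

theorem even_digit_unique {b b' : ℕ} {e e' : ℤ} {y y' : ℝ} (hb : Even b) (hb' : Even b')
    (he : e = 1 ∨ e = -1) (he' : e' = 1 ∨ e' = -1) (hy : y ∈ Ioo (0 : ℝ) 1)
    (hy' : y' ∈ Ioo (0 : ℝ) 1) (h : (b : ℝ) + e * y = b' + e' * y') :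
    b = b' ∧ e = e' ∧ y = y' := by
  obtain ⟨h0, h1⟩ := hy
  obtain ⟨h0', h1'⟩ := hy'
  have hbb : b = b' := by
    have hlt : (b : ℝ) < b' + 2 ∧ (b' : ℝ) < b + 2 := by
      rcases he with rfl | rfl <;> rcases he' with rfl | rfl <;> push_cast at h <;>
        constructor <;> linarith
    have h2 : b < b' + 2 := by exact_mod_cast hlt.1
    have h3 : b' < b + 2 := by exact_mod_cast hlt.2
    obtain ⟨m, rfl⟩ := hb
    obtain ⟨m', rfl⟩ := hb'
    omega
  subst hbb
  refine ⟨rfl, ?_⟩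
  rcases he with rfl | rfl <;> rcases he' with rfl | rfl <;> push_cast at h
  · exact ⟨rfl, by linarith⟩
  · linarith
  · linarith
  · exact ⟨rfl, by linarith⟩

theorem IsEvenDigits.eq_of_tendsto {b b' : ℕ → ℕ} {e e' : ℕ → ℤ} (h : IsEvenDigits b e)
    (h' : IsEvenDigits b' e') {x : ℝ} (hirr : Irrational x)
    (ht : Tendsto (fun n => evenCF b e n) atTop (𝓝 x))
    (ht' : Tendsto (fun n => evenCF b' e' n) atTop (𝓝 x)) (k : ℕ) :
    b k = b' k ∧ e k = e' k := by
  induction k generalizing b b' e e' x with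
  | zero =>
    obtain ⟨y, hy, -, hxy, -⟩ := h.exists_remainder hirr ht
    obtain ⟨y', hy', -, hxy', -⟩ := h'.exists_remainder hirr ht'
    obtain ⟨hb, he, -⟩ := even_digit_unique (h 0).1 (h' 0).1 (h 0).2.2 (h' 0).2.2 hy hy'
      (hxy.symm.trans hxy')
    exact ⟨hb, he⟩
  | succ k ih =>
    obtain ⟨y, hy, hyirr, hxy, hty⟩ := h.exists_remainder hirr ht
    obtain ⟨y', hy', -, hxy', hty'⟩ := h'.exists_remainder hirr ht'
    obtain ⟨-, -, rfl⟩ := even_digit_unique (h 0).1 (h' 0).1 (h 0).2.2 (h' 0).2.2 hy hy'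
      (hxy.symm.trans hxy')
    exact ih h.shift h'.shift hyirr hty hty'

/-- **Theorem.** Every irrational `x ∈ (0,1)` has a unique even-integer continued fraction
expansion: exactly one pair of sequences of positive even integers `b_n` and signs
`ε_n ∈ {1,-1}` with `x = lim_n 1/(b₁ + ε₁/(b₂ + ⋯ + ε_{n-1}/b_n))`. -/
theorem even_integer_cf_expansion (x : ℝ) (hx : x ∈ Ioo (0:ℝ) 1) (hirr : Irrational x) :
    ∃! be : (ℕ → ℕ) × (ℕ → ℤ),
      (∀ k, Even (be.1 k) ∧ 0 < be.1 k ∧ (be.2 k = 1 ∨ be.2 k = -1)) ∧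
      Tendsto (fun n => evenCF be.1 be.2 n) atTop (𝓝 x) := by
  have hdigit : ∀ z : {z : ℝ // z ∈ Ioo (0 : ℝ) 1 ∧ Irrational z},
      ∃ (b : ℕ) (e : ℤ) (y : {z : ℝ // z ∈ Ioo (0 : ℝ) 1 ∧ Irrational z}),
        (Even b ∧ 0 < b ∧ (e = 1 ∨ e = -1)) ∧ (z : ℝ) = 1 / ((b : ℝ) + e * y) := by
    rintro ⟨z, hz, hzirr⟩
    obtain ⟨b, e, y, hbe, hy, hzy⟩ := exists_even_digit hz hzirr
    exact ⟨b, e, ⟨y, hy⟩, hbe, hzy⟩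
  choose B E T hBE hT using hdigit
  let X : ℕ → {z : ℝ // z ∈ Ioo (0 : ℝ) 1 ∧ Irrational z} := fun n => T^[n] ⟨x, hx, hirr⟩
  have hdig : IsEvenDigits (fun k => B (X k)) (fun k => E (X k)) := fun k => hBE (X k)
  have hlim : Tendsto (fun n => evenCF (fun k => B (X k)) (fun k => E (X k)) n) atTop (𝓝 x) := by
    refine hdig.tendsto_evenCF (X := fun k => (X k : ℝ))
      (fun k => Ioo_subset_Icc_self (X k).2.1) fun k => ?_
    have hsucc : X (k + 1) = T (X k) := Function.iterate_succ_apply' T k _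
    rw [hsucc]
    exact hT (X k)
  refine ⟨(fun k => B (X k), fun k => E (X k)), ⟨hdig, hlim⟩, ?_⟩
  rintro ⟨b, e⟩ ⟨hd, ht⟩
  have heq := IsEvenDigits.eq_of_tendsto hd hdig hirr ht hlim
  exact Prod.ext (funext fun k => (heq k).1) (funext fun k => (heq k).2)
end
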